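/- arXiv:1607.00054 — 4 statements merged into one kernel-verified Lean document; each statement's English description precedes it below -/
import Mathlib

section
/- The set of isolated points of LO(F₂ × ℤ) is infinite; moreover there is an infinite family of isolated left orders on F₂ × ℤ that are pairwise non-conjugate under the conjugation action of F₂ × ℤ on LO(F₂ × ℤ). -/
noncomputable section

variable {G : Type*} [Group G]

/-- A left-invariant (strict) total order on a group `G`. -/
def IsLeftOrder (r : G → G → Prop) : Prop :=
  (∀ a, ¬ r a a) ∧ (∀ a b c, r a b → r b c → r a c) ∧
  (∀ a b, a ≠ b → r a b ∨ r b a) ∧ (∀ g a b, r a b → r (g * a) (g * b))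

/-- `r` is an isolated point of the space `LO(G)` of left orders on `G` (topologized as a
subspace of `{0,1}^{G×G}` via characteristic functions): some basic neighborhood, determined
by agreement on a finite subset of `G`, contains only `r`. -/
def IsIsolatedLO (r : G → G → Prop) : Prop :=
  ∃ S : Finset G, ∀ r' : G → G → Prop, IsLeftOrder r' →
    (∀ a ∈ S, ∀ b ∈ S, (r' a b ↔ r a b)) → r' = r

end

namespace F2Z

section abstractPart
variable {H : Type*} [Group H]

/-- Normal forms starting with `b` (or trivial) at a level. -/
inductive E (a b : ZMod 4 → H) : ZMod 4 → H → Prop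
  | one (i) : E a b i 1
  | b0 (i t) : E a b (i+1) t → E a b i (b i * t)
  | b1 (i t) : E a b i t → E a b i (b i * (a (i+1) * t))
  | b2 (i t) : E a b (i-1) t → E a b i (b i * (a (i+1) * (a i * t)))
  | b3 (i) : E a b i (b i * (a (i+1) * (a i * a (i-1))))

def Nf (a b : ZMod 4 → H) (i : ZMod 4) (p : H) : Prop :=
  E a b i p ∨ (∃ t, E a b (i-1) t ∧ p = a i * t) ∨
  (∃ t, E a b (i-2) t ∧ p = a i * (a (i-1) * t)) ∨
  (∃ t, E a b (i-3) t ∧ p = a i * (a (i-1) * (a (i-2) * t)))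

structure Data (a b : ZMod 4 → H) (z : H) (M : Submonoid H) : Prop where
  comm : ∀ g, z * g = g * z
  rel : ∀ i, b i * (a (i+1) * (a i * (a (i-1) * b (i-2)))) = a i
  hz : ∀ i, a i * (a (i-1) * (a (i-2) * a (i-3))) = z
  ha : ∀ i, a i ∈ M
  hb : ∀ i, b i ∈ M

variable {a b : ZMod 4 → H} {z : H} {M : Submonoid H}

lemma Data.zM (D : Data a b z M) : z ∈ M := by
  rw [← D.hz 0]
  exact M.mul_mem (D.ha _) (M.mul_mem (D.ha _) (M.mul_mem (D.ha _) (D.ha _)))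

lemma Data.E_mem (D : Data a b z M) {i t} (h : E a b i t) : t ∈ M := by
  have ha := D.ha
  have hb := D.hb
  induction h with
  | one => exact M.one_mem
  | b0 i t _ ih => exact M.mul_mem (hb _) ih
  | b1 i t _ ih => exact M.mul_mem (hb _) (M.mul_mem (ha _) ih)
  | b2 i t _ ih => exact M.mul_mem (hb _) (M.mul_mem (ha _) (M.mul_mem (ha _) ih))
  | b3 i => exact M.mul_mem (hb _) (M.mul_mem (ha _) (M.mul_mem (ha _) (ha _)))

lemma Data.Nf_mem (D : Data a b z M) {i p} (h : Nf a b i p) : p ∈ M := by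
  have ha := D.ha
  rcases h with h | ⟨t, h, rfl⟩ | ⟨t, h, rfl⟩ | ⟨t, h, rfl⟩
  · exact D.E_mem h
  · exact M.mul_mem (ha _) (D.E_mem h)
  · exact M.mul_mem (ha _) (M.mul_mem (ha _) (D.E_mem h))
  · exact M.mul_mem (ha _) (M.mul_mem (ha _) (M.mul_mem (ha _) (D.E_mem h)))

lemma Data.E_lt (D : Data a b z M) {i t} (h : E a b i t) : t⁻¹ * a i ∈ M := by
  have ha := D.ha
  have hb := D.hb
  induction h with
  | one i => simpa using ha i
  | b0 i t _ ih =>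
    have : (b i * t)⁻¹ * a i = (t⁻¹ * a (i+1)) * (a i * (a (i-1) * b (i-2))) := by
      conv_lhs => rw [← D.rel i]
      group
    rw [this]
    exact M.mul_mem ih (M.mul_mem (ha _) (M.mul_mem (ha _) (hb _)))
  | b1 i t _ ih =>
    have : (b i * (a (i+1) * t))⁻¹ * a i = (t⁻¹ * a i) * (a (i-1) * b (i-2)) := by
      conv_lhs => rw [← D.rel i]
      group
    rw [this]
    exact M.mul_mem ih (M.mul_mem (ha _) (hb _))
  | b2 i t _ ih =>
    have : (b i * (a (i+1) * (a i * t)))⁻¹ * a i = (t⁻¹ * a (i-1)) * (b (i-2)) := by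
      conv_lhs => enter [2]; rw [← D.rel i]
      group
    rw [this]
    exact M.mul_mem ih (hb _)
  | b3 i =>
    have : (b i * (a (i+1) * (a i * a (i-1))))⁻¹ * a i = b (i-2) := by
      conv_lhs => enter [2]; rw [← D.rel i]
      group
    rw [this]
    exact hb _

lemma Data.Nf_lt (D : Data a b z M) {i p} (h : Nf a b i p) : p⁻¹ * z ∈ M := by
  have ha := D.ha
  rw [← D.hz i]
  rcases h with h | ⟨t, h, rfl⟩ | ⟨t, h, rfl⟩ | ⟨t, h, rfl⟩
  · rw [← mul_assoc]
    exact M.mul_mem (D.E_lt h) (M.mul_mem (ha _) (M.mul_mem (ha _) (ha _)))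
  · have : (a i * t)⁻¹ * (a i * (a (i-1) * (a (i-2) * a (i-3)))) =
      (t⁻¹ * a (i-1)) * (a (i-2) * a (i-3)) := by group
    rw [this]
    exact M.mul_mem (D.E_lt h) (M.mul_mem (ha _) (ha _))
  · have : (a i * (a (i-1) * t))⁻¹ * (a i * (a (i-1) * (a (i-2) * a (i-3)))) =
      (t⁻¹ * a (i-2)) * (a (i-3)) := by group
    rw [this]
    exact M.mul_mem (D.E_lt h) (ha _)
  · have : (a i * (a (i-1) * (a (i-2) * t)))⁻¹ * (a i * (a (i-1) * (a (i-2) * a (i-3)))) =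
      (t⁻¹ * a (i-3)) := by group
    rw [this]
    exact D.E_lt h

def Nz (a b : ZMod 4 → H) (z : H) (i : ZMod 4) (g : H) : Prop :=
  ∃ (j : ℤ) (p : H), Nf a b i p ∧ g = z ^ j * p

lemma Data.zcomm (D : Data a b z M) (j : ℤ) (g : H) : g * z ^ j = z ^ j * g :=
  ((show Commute z g from D.comm g).zpow_left j).eq.symm

lemma Nf.nz {i p} (h : Nf a b i p) : Nz a b z i p := ⟨0, p, h, by simp⟩

lemma Data.nz_z (_D : Data a b z M) {i g} (j : ℤ) (h : Nz a b z i g) : Nz a b z i (z ^ j * g) := by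
  obtain ⟨k, p, hp, rfl⟩ := h
  exact ⟨j + k, p, hp, by rw [zpow_add, mul_assoc]⟩

lemma Data.aNf (D : Data a b z M) {i p} (h : Nf a b (i-1) p) : Nz a b z i (a i * p) := by
  have e2 : i - 1 - 1 = i - 2 := by ring
  have e3 : i - 1 - 2 = i - 3 := by ring
  have e4 : i - 1 - 3 = i := by clear * -; decide +revert
  rcases h with h | ⟨t, h, rfl⟩ | ⟨t, h, rfl⟩ | ⟨t, h, rfl⟩
  · exact Nf.nz (Or.inr (Or.inl ⟨_, h, rfl⟩))
  · rw [e2] at h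
    exact Nf.nz (Or.inr (Or.inr (Or.inl ⟨_, h, rfl⟩)))
  · rw [e2]
    rw [e3] at h
    exact Nf.nz (Or.inr (Or.inr (Or.inr ⟨_, h, rfl⟩)))
  · rw [e2, e3]
    rw [e4] at h
    refine ⟨1, t, Or.inl h, ?_⟩
    rw [← D.hz i]
    group

lemma Data.a_nz (D : Data a b z M) {i g} (h : Nz a b z (i-1) g) : Nz a b z i (a i * g) := by
  obtain ⟨j, p, hp, rfl⟩ := h
  rw [← mul_assoc, D.zcomm, mul_assoc]
  exact D.nz_z j (D.aNf hp)

lemma Data.bNf (D : Data a b z M) {i p} (h : Nf a b (i+1) p) : Nz a b z i (b i * p) := by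
  have e1 : i + 1 - 1 = i := by ring
  have e2 : i + 1 - 2 = i - 1 := by ring
  have e3 : i + 1 - 3 = i - 2 := by ring
  have e4 : i - 2 + 1 = i - 1 := by ring
  have e5 : i - 2 - 1 = i - 1 - 2 := by ring
  have e5' : i - 2 = i - 1 - 1 := by ring
  rcases h with h | ⟨t, h, rfl⟩ | ⟨t, h, rfl⟩ | ⟨t, h, rfl⟩
  · exact Nf.nz (Or.inl (E.b0 _ _ h))
  · rw [e1] at h
    exact Nf.nz (Or.inl (E.b1 _ _ h))
  · rw [e2] at h
    rw [e1]
    exact Nf.nz (Or.inl (E.b2 _ _ h))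
  · rw [e3] at h
    rw [e1, e2]
    have key : ∀ q, b i * (a (i+1) * (a i * (a (i-1) * (b (i-2) * q)))) = a i * q := by
      intro q
      conv_rhs => rw [← D.rel i]
      group
    generalize hk : i - 2 = k at h
    cases h with
    | one => exact Nf.nz (Or.inl (by simpa using E.b3 i))
    | b0 _ t h =>
      subst hk
      rw [key]
      rw [e4] at h
      exact D.aNf (Or.inl h)
    | b1 _ t h =>
      subst hk
      rw [key, e4]
      rw [e5'] at h
      exact D.aNf (Or.inr (Or.inl ⟨_, h, rfl⟩))
    | b2 _ t h =>
      subst hk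
      rw [key, e4]
      rw [e5] at h
      refine D.aNf (Or.inr (Or.inr (Or.inl ⟨_, h, ?_⟩)))
      rw [← e5']
    | b3 =>
      subst hk
      rw [key, e4]
      refine D.aNf (Or.inr (Or.inr (Or.inr ⟨1, E.one _, ?_⟩)))
      rw [← e5', e5, mul_one]

lemma Data.b_nz (D : Data a b z M) {i g} (h : Nz a b z (i+1) g) : Nz a b z i (b i * g) := by
  obtain ⟨j, p, hp, rfl⟩ := h
  rw [← mul_assoc, D.zcomm, mul_assoc]
  exact D.nz_z j (D.bNf hp)

lemma Data.b_inv_nz (D : Data a b z M) {i g} (h : Nz a b z i (b i * g)) : Nz a b z (i+1) g := by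
  have e1 : i + 1 - 1 = i := by ring
  have e2 : i - 1 - 1 = i - 2 := by ring
  have e3 : i - 2 + 1 = i - 1 := by ring
  have e4 : i - 2 - 1 = i - 3 := by ring
  have e5 : i - 3 = i + 1 := by clear * -; decide +revert
  have e6 : i - 3 - 1 = i := by clear * -; decide +revert
  have h1 : Nz a b z (i-3) (a (i-3) * (b i * g)) := D.a_nz (by rwa [e6])
  have h2 : Nz a b z (i-2) (a (i-2) * (a (i-3) * (b i * g))) := D.a_nz (by rwa [e4])
  have h3 := D.a_nz (i := i-1) (by rw [e2]; exact h2)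
  have h4 := D.b_nz (i := i-2) (by rw [e3]; exact h3)
  have h5 := D.a_nz (i := i-1) (by rw [e2]; exact h4)
  have h6 := D.a_nz (i := i) h5
  have h7 := D.a_nz (i := i+1) (by rw [e1]; exact h6)
  have h8 := D.nz_z (-1) h7
  convert h8 using 1
  have r := D.rel i
  have hz := D.hz i
  have : b i * (a (i+1) * (a i * (a (i-1) * (b (i-2) * (a (i-1) * (a (i-2) * (a (i-3) * (b i * g)))))))) = z * (b i * g) := by
    calc _ = (b i * (a (i+1) * (a i * (a (i-1) * b (i-2))))) * (a (i-1) * (a (i-2) * (a (i-3) * (b i * g)))) := by group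
      _ = (a i * (a (i-1) * (a (i-2) * a (i-3)))) * (b i * g) := by rw [r]; group
      _ = _ := by rw [hz]
  have this2 : a (i+1) * (a i * (a (i-1) * (b (i-2) * (a (i-1) * (a (i-2) * (a (i-3) * (b i * g))))))) = z * g := by
    apply mul_left_cancel (a := b i)
    rw [this, ← mul_assoc, D.comm, mul_assoc]
  rw [this2]
  group

lemma Data.nz_cmp (D : Data a b z M) {i g} (h : Nz a b z i g) : g ∈ M ∨ g⁻¹ ∈ M := by
  obtain ⟨j, p, hp, rfl⟩ := h
  rcases le_or_gt 0 j with hj | hj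
  · left
    lift j to ℕ using hj
    rw [zpow_natCast]
    exact M.mul_mem (M.pow_mem D.zM _) (D.Nf_mem hp)
  · right
    obtain ⟨k, hk⟩ : ∃ k : ℕ, j = -1 - k := ⟨(-1 - j).toNat, by omega⟩
    have : (z ^ j * p)⁻¹ = (p⁻¹ * z) * z ^ k := by
      rw [hk, mul_inv_rev, ← zpow_neg, mul_assoc, ← pow_succ', ← zpow_natCast]
      congr 2
      push_cast; ring
    rw [this]
    exact M.mul_mem (D.Nf_lt hp) (M.pow_mem D.zM _)

end abstractPart

/-! ### The concrete group -/

noncomputable section concretePart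

abbrev Gp : Type := FreeGroup (Fin 2) × Multiplicative ℤ

def gx : Gp := (FreeGroup.of 0, 1)
def gy : Gp := (FreeGroup.of 1, 1)
def gz : Gp := (1, Multiplicative.ofAdd 1)

def s2 : Gp := gz * gx⁻¹
def s3 : Gp := gx⁻¹ * gy⁻¹ * gx
def ge : Gp := gz⁻¹ * (gx⁻¹ * gy⁻¹ * gx * gy)

def aa : ZMod 4 → Gp := (![gx, gy, s2, s3] : Fin 4 → Gp)
def bb : ZMod 4 → Gp := (![1, 1, 1, ge] : Fin 4 → Gp)

def SS : Set Gp := {gx, gy, s2, s3, ge}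

def MM : Submonoid Gp := Submonoid.closure SS

lemma gz_comm (g : Gp) : gz * g = g * gz := by
  ext
  · simp [gz]
  · simp [gz, mul_comm]

lemma dat : Data aa bb gz MM := by
  have h0 : gx ∈ MM := Submonoid.subset_closure (by simp [SS])
  have h1 : gy ∈ MM := Submonoid.subset_closure (by simp [SS])
  have h2 : s2 ∈ MM := Submonoid.subset_closure (by simp [SS])
  have h3 : s3 ∈ MM := Submonoid.subset_closure (by simp [SS])
  have h4 : ge ∈ MM := Submonoid.subset_closure (by simp [SS])
  refine ⟨gz_comm, ?_, ?_, ?_, ?_⟩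
  · intro i
    fin_cases i
    · show (1 : Gp) * (gy * (gx * (s3 * 1))) = gx
      simp only [s3]; group
    · show (1 : Gp) * (s2 * (gy * (gx * ge))) = gy
      ext
      · simp [s2, ge, gx, gy, gz, mul_assoc]
      · simp [s2, ge, gx, gy, gz]
    · show (1 : Gp) * (s3 * (s2 * (gy * 1))) = s2
      ext
      · simp [s2, s3, gx, gy, gz]
      · simp [s2, s3, gx, gy, gz]
    · show ge * (gx * (s3 * (s2 * 1))) = s3
      ext
      · simp [s2, s3, ge, gx, gy, gz, mul_assoc]
      · simp [s2, s3, ge, gx, gy, gz]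
  · intro i
    fin_cases i
    · show gx * (s3 * (s2 * gy)) = gz
      ext
      · simp [s2, s3, gx, gy, gz, mul_assoc]
      · simp [s2, s3, gx, gy, gz]
    · show gy * (gx * (s3 * s2)) = gz
      ext
      · simp [s2, s3, gx, gy, gz, mul_assoc]
      · simp [s2, s3, gx, gy, gz]
    · show s2 * (gy * (gx * s3)) = gz
      ext
      · simp [s2, s3, gx, gy, gz, mul_assoc]
      · simp [s2, s3, gx, gy, gz]
    · show s3 * (s2 * (gy * gx)) = gz
      ext
      · simp [s2, s3, gx, gy, gz, mul_assoc]
      · simp [s2, s3, gx, gy, gz]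
  · intro i
    fin_cases i
    · exact h0
    · exact h1
    · exact h2
    · exact h3
  · intro i
    fin_cases i
    · exact MM.one_mem
    · exact MM.one_mem
    · exact MM.one_mem
    · exact h4

lemma up10 {g : Gp} (h : Nz aa bb gz 0 g) : Nz aa bb gz 1 g :=
  dat.b_inv_nz (i := 0) (show Nz aa bb gz 0 (1 * g) by rwa [one_mul])
lemma up21 {g : Gp} (h : Nz aa bb gz 1 g) : Nz aa bb gz 2 g :=
  dat.b_inv_nz (i := 1) (show Nz aa bb gz 1 (1 * g) by rwa [one_mul])
lemma up32 {g : Gp} (h : Nz aa bb gz 2 g) : Nz aa bb gz 3 g :=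
  dat.b_inv_nz (i := 2) (show Nz aa bb gz 2 (1 * g) by rwa [one_mul])
lemma dn10 {g : Gp} (h : Nz aa bb gz 1 g) : Nz aa bb gz 0 g := by
  have := dat.b_nz (i := 0) h
  rwa [show bb 0 = 1 from rfl, one_mul] at this
lemma dn21 {g : Gp} (h : Nz aa bb gz 2 g) : Nz aa bb gz 1 g := by
  have := dat.b_nz (i := 1) h
  rwa [show bb 1 = 1 from rfl, one_mul] at this
lemma dn32 {g : Gp} (h : Nz aa bb gz 3 g) : Nz aa bb gz 2 g := by
  have := dat.b_nz (i := 2) h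
  rwa [show bb 2 = 1 from rfl, one_mul] at this

lemma cl_x {g : Gp} (h : Nz aa bb gz 0 g) : Nz aa bb gz 0 (gx * g) :=
  dat.a_nz (i := 0) (up32 (up21 (up10 h)))
lemma cl_y {g : Gp} (h : Nz aa bb gz 0 g) : Nz aa bb gz 0 (gy * g) :=
  dn10 (dat.a_nz (i := 1) h)
lemma cl_s2 {g : Gp} (h : Nz aa bb gz 0 g) : Nz aa bb gz 0 (s2 * g) :=
  dn10 (dn21 (dat.a_nz (i := 2) (up10 h)))
lemma cl_s3 {g : Gp} (h : Nz aa bb gz 0 g) : Nz aa bb gz 0 (s3 * g) :=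
  dn10 (dn21 (dn32 (dat.a_nz (i := 3) (up21 (up10 h)))))
lemma cl_xi {g : Gp} (h : Nz aa bb gz 0 g) : Nz aa bb gz 0 (gx⁻¹ * g) := by
  have := dat.nz_z (-1) (cl_s2 h)
  convert this using 1
  simp only [s2]; group
lemma cl_yi {g : Gp} (h : Nz aa bb gz 0 g) : Nz aa bb gz 0 (gy⁻¹ * g) := by
  have := cl_x (cl_s3 (cl_xi h))
  convert this using 1
  simp only [s3]; group

lemma all_nz (g : Gp) : Nz aa bb gz 0 g := by
  obtain ⟨w, n⟩ := g
  have key : ∀ w : FreeGroup (Fin 2), ∀ g, Nz aa bb gz 0 g → Nz aa bb gz 0 ((w, 1) * g) := by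
    intro w
    induction w using FreeGroup.induction_on with
    | C1 => intro g h; rwa [show ((1, 1) : Gp) = 1 from rfl, one_mul]
    | of i =>
      intro g h
      fin_cases i
      · exact cl_x h
      · exact cl_y h
    | inv_of i _ =>
      intro g h
      fin_cases i
      · exact cl_xi h
      · exact cl_yi h
    | mul u v hu hv =>
      intro g h
      have := hu _ (hv _ h)
      rw [← mul_assoc] at this
      simpa using this
  have h1 : Nz aa bb gz 0 (1 : Gp) := Nf.nz (Or.inl (E.one _))
  have h2 := key w _ (dat.nz_z n.toAdd h1)
  convert h2 using 1
  ext
  · simp [gz]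
  · simp [gz, ← ofAdd_zsmul]

lemma total (g : Gp) : g ∈ MM ∨ g⁻¹ ∈ MM := dat.nz_cmp (all_nz g)

lemma z_pow_mem {j : ℤ} (hj : 0 ≤ j) : gz ^ j ∈ MM := by
  lift j to ℕ using hj
  rw [zpow_natCast]
  exact MM.pow_mem dat.zM _

lemma cofinal (g : Gp) : ∃ N : ℕ, ∀ j : ℤ, N ≤ j → gz ^ j * g ∈ MM := by
  obtain ⟨j, p, hp, rfl⟩ := all_nz g
  refine ⟨(-j).toNat, fun k hk => ?_⟩
  rw [← mul_assoc, ← zpow_add]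
  exact MM.mul_mem (z_pow_mem (by omega)) (dat.Nf_mem hp)

/-! ### The action on the line -/

def kap (t : ℝ) : ℝ := ⌊t⌋ + min (3 * Int.fract t) ((Int.fract t + 2) / 3)
def kap' (t : ℝ) : ℝ := ⌊t⌋ + max (Int.fract t / 3) (3 * Int.fract t - 2)

lemma floor_fract_add (n : ℤ) {s : ℝ} (h0 : 0 ≤ s) (h1 : s < 1) :
    ⌊(n : ℝ) + s⌋ = n ∧ Int.fract ((n : ℝ) + s) = s := by
  have : ⌊(n : ℝ) + s⌋ = n := by
    rw [Int.floor_eq_iff]; constructor <;> linarith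
  refine ⟨this, ?_⟩
  rw [Int.fract, this]; ring

lemma kap_left (t : ℝ) : kap' (kap t) = t := by
  have h0 := Int.fract_nonneg t
  have h1 := Int.fract_lt_one t
  have h2 := Int.floor_add_fract t
  obtain ⟨e1, e2⟩ := floor_fract_add ⌊t⌋ (s := min (3 * Int.fract t) ((Int.fract t + 2) / 3))
    (by apply le_min <;> linarith) (by apply min_lt_of_right_lt; linarith)
  rw [kap', kap, e1, e2]
  rcases le_total (3 * Int.fract t) ((Int.fract t + 2) / 3) with h | h
  · rw [min_eq_left h, max_eq_left (by linarith)]; linarith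
  · rw [min_eq_right h, max_eq_right (by linarith)]; linarith

lemma kap_right (t : ℝ) : kap (kap' t) = t := by
  have h0 := Int.fract_nonneg t
  have h1 := Int.fract_lt_one t
  have h2 := Int.floor_add_fract t
  obtain ⟨e1, e2⟩ := floor_fract_add ⌊t⌋ (s := max (Int.fract t / 3) (3 * Int.fract t - 2))
    (by apply le_max_of_le_left; linarith) (by apply max_lt <;> linarith)
  rw [kap, kap', e1, e2]
  rcases le_total (Int.fract t / 3) (3 * Int.fract t - 2) with h | h
  · rw [max_eq_right h, min_eq_right (by linarith)]; linarith
  · rw [max_eq_left h, min_eq_left (by linarith)]; linarith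

lemma kap_mono : Monotone kap := by
  intro s t h
  have h0 := Int.fract_nonneg t
  have h1 := Int.fract_lt_one t
  have h2 := Int.floor_add_fract t
  have h0' := Int.fract_nonneg s
  have h1' := Int.fract_lt_one s
  have h2' := Int.floor_add_fract s
  rcases (Int.floor_mono h).lt_or_eq with hl | hl
  · have : (⌊s⌋ : ℝ) + 1 ≤ ⌊t⌋ := by exact_mod_cast hl
    have i1 : min (3 * Int.fract s) ((Int.fract s + 2) / 3) ≤ 1 :=
      (min_le_right _ _).trans (by linarith)
    have i2 : 0 ≤ min (3 * Int.fract t) ((Int.fract t + 2) / 3) := by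
      apply le_min <;> linarith
    rw [kap, kap]; linarith
  · have : Int.fract s ≤ Int.fract t := by
      rw [hl] at h2'; linarith
    rw [kap, kap, hl]
    gcongr

lemma kap'_mono : Monotone kap' := by
  intro s t h
  have h3 : StrictMono kap := kap_mono.strictMono_of_injective
    (Function.LeftInverse.injective kap_left)
  rw [← h3.le_iff_le, kap_right, kap_right]
  exact h

lemma kap_add (t : ℝ) : kap (t + 1) = kap t + 1 := by
  simp only [kap, Int.floor_add_one, Int.fract_add_one]
  push_cast; ring

lemma kap'_add (t : ℝ) : kap' (t + 1) = kap' t + 1 := by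
  simp only [kap', Int.floor_add_one, Int.fract_add_one]
  push_cast; ring

def kapIso : ℝ ≃o ℝ :=
  { toFun := kap, invFun := kap', left_inv := kap_left, right_inv := kap_right,
    map_rel_iff' := by
      intro s t
      exact ⟨fun h => by simpa [kap_left] using kap'_mono h, fun h => kap_mono h⟩ }

def fx : ℝ ≃o ℝ := kapIso.trans (OrderIso.addRight (3/4))
def fy : ℝ ≃o ℝ := kapIso.symm.trans (OrderIso.addRight (1/4))
def fz : ℝ ≃o ℝ := OrderIso.addRight 1

lemma fx_apply (t : ℝ) : fx t = kap t + 3/4 := rfl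
lemma fy_apply (t : ℝ) : fy t = kap' t + 1/4 := rfl
lemma fz_apply (t : ℝ) : fz t = t + 1 := rfl

def fw : FreeGroup (Fin 2) →* (ℝ ≃o ℝ) := FreeGroup.lift ![fx, fy]
def fn : Multiplicative ℤ →* (ℝ ≃o ℝ) := zpowersHom _ fz

lemma fcomm (w : FreeGroup (Fin 2)) (n : Multiplicative ℤ) : Commute (fw w) (fn n) := by
  have h : Commute (fw w) fz := by
    induction w using FreeGroup.induction_on with
    | C1 => simp
    | of i =>
      fin_cases i
      · show fw (FreeGroup.of 0) * fz = fz * fw (FreeGroup.of 0)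
        simp only [fw, FreeGroup.lift_apply_of]
        ext t
        show fx (fz t) = fz (fx t)
        rw [fx_apply, fz_apply, fz_apply, fx_apply, kap_add]; ring
      · show fw (FreeGroup.of 1) * fz = fz * fw (FreeGroup.of 1)
        simp only [fw, FreeGroup.lift_apply_of]
        ext t
        show fy (fz t) = fz (fy t)
        rw [fy_apply, fz_apply, fz_apply, fy_apply, kap'_add]; ring
    | inv_of i h => rw [map_inv]; exact h.inv_left
    | mul u v hu hv => rw [map_mul]; exact hu.mul_left hv
  exact h.zpow_right n.toAdd

def act : Gp →* (ℝ ≃o ℝ) := MonoidHom.noncommCoprod fw fn fcomm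

lemma act_x : act gx = fx := by simp [act, gx, fw]
lemma act_y : act gy = fy := by simp [act, gy, fw]
lemma act_z : act gz = fz := by simp [act, gz, fn]

lemma kap_zero : kap 0 = 0 := by norm_num [kap]
lemma kap'_zero : kap' 0 = 0 := by norm_num [kap']
lemma kap_q : kap (1/4) = 3/4 := by
  obtain ⟨e1, e2⟩ := floor_fract_add 0 (s := 1/4) (by norm_num) (by norm_num)
  rw [Int.cast_zero, zero_add] at e1 e2
  rw [kap, e1, e2]; norm_num
lemma kap'_q : kap' (3/4) = 1/4 := by
  rw [← kap_q, kap_left]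

lemma fx0 : fx 0 = 3/4 := by rw [fx_apply, kap_zero]; norm_num
lemma fy0 : fy 0 = 1/4 := by rw [fy_apply, kap'_zero]; norm_num
lemma fyu : fy (3/4) = 1/2 := by rw [fy_apply, kap'_q]; norm_num
lemma fxw : fx (1/4) = 3/2 := by rw [fx_apply, kap_q]; norm_num

lemma inv_app (f : ℝ ≃o ℝ) (t : ℝ) : f⁻¹ t = f.symm t := rfl
lemma mul_app (f g : ℝ ≃o ℝ) (t : ℝ) : (f * g) t = f (g t) := rfl

lemma act_s2 : 0 < act s2 0 := by
  have : act s2 = fx⁻¹ * fz := by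
    rw [s2, gz_comm, map_mul, map_inv, act_x, act_z]
  rw [this, mul_app, inv_app, OrderIso.lt_symm_apply, fx0, fz_apply]
  norm_num

lemma act_s3 : 0 < act s3 0 := by
  rw [s3, mul_assoc, map_mul, map_mul, map_inv, map_inv, act_x, act_y, mul_app, mul_app,
    inv_app, inv_app, OrderIso.lt_symm_apply, OrderIso.lt_symm_apply, fx0, fyu]
  norm_num

lemma act_e : act ge 0 = 0 := by
  have : act ge = fz⁻¹ * (fx⁻¹ * (fy⁻¹ * (fx * fy))) := by
    simp only [ge, map_mul, map_inv, act_x, act_y, act_z, mul_assoc]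
  rw [this]
  simp only [mul_app, inv_app]
  rw [OrderIso.symm_apply_eq, OrderIso.symm_apply_eq, OrderIso.symm_apply_eq, fy0, fxw, fz_apply,
    fx_apply, fy_apply, kap_add, kap_zero]
  rw [show (0 + 1 + 3/4 : ℝ) = 3/4 + 1 by norm_num, kap'_add, kap'_q]
  norm_num

lemma pos_or (g : Gp) (h : g ∈ MM) : 0 < act g 0 ∨ ∃ n : ℕ, g = ge ^ n := by
  have nn : ∀ g : Gp, (0 < act g 0 ∨ ∃ n : ℕ, g = ge ^ n) → 0 ≤ act g 0 := by
    rintro g (h | ⟨n, rfl⟩)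
    · exact h.le
    · apply le_of_eq
      induction n with
      | zero => simp
      | succ n ih => rw [pow_succ, map_mul, mul_app, act_e, ← ih]
  induction h using Submonoid.closure_induction with
  | mem s hs =>
    rcases hs with rfl | rfl | rfl | rfl | rfl
    · left; rw [act_x, fx0]; norm_num
    · left; rw [act_y, fy0]; norm_num
    · left; exact act_s2
    · left; exact act_s3
    · right; exact ⟨1, by simp⟩
  | one => right; exact ⟨0, by simp⟩
  | mul u v _ _ hu hv =>
    rcases hu with hu' | ⟨n, hn⟩
    · left
      rw [map_mul, mul_app]
      exact hu'.trans_le ((act u).monotone (nn v hv))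
    · rcases hv with hv' | ⟨k, hk⟩
      · left
        rw [map_mul, mul_app]
        exact (nn u (Or.inr ⟨n, hn⟩)).trans_lt ((act u).strictMono hv')
      · right; exact ⟨n + k, by rw [hn, hk, pow_add]⟩

lemma pointed (g : Gp) (h : g ∈ MM) (h' : g⁻¹ ∈ MM) : g = 1 := by
  have key : ∀ g : Gp, 0 < act g 0 → g⁻¹ ∈ MM → False := by
    intro g h h'
    have : act g⁻¹ 0 < 0 := by
      rw [map_inv, inv_app, OrderIso.symm_apply_lt]; exact h
    rcases pos_or _ h' with h1 | ⟨n, hn⟩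
    · linarith
    · have e : g = (ge ^ n)⁻¹ := by rw [← hn, inv_inv]
      have : ∀ n : ℕ, act (ge ^ n) 0 = 0 := by
        intro n
        induction n with
        | zero => simp
        | succ n ih => rw [pow_succ, map_mul, mul_app, act_e, ih]
      have h3 := this n
      rw [← hn] at h3
      linarith
  rcases pos_or _ h with h1 | ⟨n, hn⟩
  · exact (key g h1 h').elim
  · rcases pos_or _ h' with h1 | ⟨k, hk⟩
    · exact (key _ h1 (by simpa using h)).elim
    · have h3 : ge ^ (n + k) = 1 := by rw [pow_add, ← hn, ← hk]; simp
      have h4 := congrArg (fun u : Gp => u.2.toAdd) h3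
      simp [ge, gx, gy, gz] at h4
      have : n = 0 := by omega
      rw [hn, this, pow_zero]

/-! ### The family of orders -/

def hx : FreeGroup (Fin 2) →* Multiplicative ℤ := FreeGroup.lift ![Multiplicative.ofAdd 1, 1]

def psi (m : ℤ) : Gp →* Gp where
  toFun g := (g.1, g.2 * hx g.1 ^ m)
  map_one' := by simp
  map_mul' g h := by
    ext
    · simp
    · simp only [Prod.fst_mul, Prod.snd_mul, map_mul, mul_zpow]
      rw [mul_mul_mul_comm]

lemma psi_psi (m : ℤ) (g : Gp) : psi m (psi (-m) g) = g := by
  simp [psi]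

lemma psi_inj (m : ℤ) {g : Gp} (h : psi m g = 1) : g = 1 := by
  have := psi_psi (-m) g
  rw [neg_neg, h, map_one] at this
  exact this.symm

lemma psi_x (m : ℤ) : psi m gx = gx * gz ^ m := by
  ext
  · simp [psi, gx, gz]
  · simp [psi, gx, gz, hx]

lemma psi_z (m : ℤ) : psi m gz = gz := by
  ext
  · simp [psi, gz]
  · simp [psi, gz, hx]

def ord (m : ℤ) (a b : Gp) : Prop := psi m (a⁻¹ * b) ∈ MM ∧ a ≠ b

lemma ord_left (m : ℤ) : IsLeftOrder (ord m) := by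
  refine ⟨fun a h => h.2 rfl, ?_, ?_, ?_⟩
  · rintro a b c ⟨h1, h2⟩ ⟨h3, h4⟩
    have h5 : psi m (a⁻¹ * c) = psi m (a⁻¹ * b) * psi m (b⁻¹ * c) := by
      rw [← map_mul]; congr 1; group
    refine ⟨by rw [h5]; exact MM.mul_mem h1 h3, ?_⟩
    rintro rfl
    apply h2
    have : psi m (a⁻¹ * b) = 1 := by
      apply pointed _ h1
      rw [← map_inv]
      simpa using h3
    have := psi_inj m this
    exact inv_mul_eq_one.mp this
  · intro a b hab
    rcases total (psi m (a⁻¹ * b)) with h | h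
    · exact Or.inl ⟨h, hab⟩
    · right
      refine ⟨?_, hab.symm⟩
      rw [← map_inv] at h
      simpa using h
  · rintro g a b ⟨h1, h2⟩
    refine ⟨?_, by simpa using h2⟩
    convert h1 using 2
    group

lemma ord_iso (m : ℤ) : IsIsolatedLO (ord m) := by
  classical
  refine ⟨{1} ∪ ({gx, gy, s2, s3, ge} : Finset Gp).image (psi (-m)), ?_⟩
  rintro r ⟨irr, tr, tot, inv⟩ hS
  have hs : ∀ s ∈ SS, psi (-m) s = 1 ∨ r 1 (psi (-m) s) := by
    intro s hs
    by_cases h : psi (-m) s = 1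
    · exact Or.inl h
    · right
      rw [hS 1 (by simp) (psi (-m) s)]
      · refine ⟨?_, Ne.symm h⟩
        rw [inv_one, one_mul, psi_psi]
        exact Submonoid.subset_closure hs
      · apply Finset.mem_union_right
        apply Finset.mem_image_of_mem
        simpa [SS] using hs
  have hM : ∀ g ∈ MM, psi (-m) g = 1 ∨ r 1 (psi (-m) g) := by
    intro g hg
    induction hg using Submonoid.closure_induction with
    | mem s h => exact hs s h
    | one => left; simp
    | mul u v _ _ hu hv =>
      rw [map_mul]
      rcases hu with hu | hu
      · rw [hu, one_mul]; exact hv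
      · right
        rcases hv with hv | hv
        · rw [hv, mul_one]; exact hu
        · refine tr _ _ _ hu ?_
          simpa using inv (psi (-m) u) _ _ hv
  have key : ∀ a b, ord m a b → r a b := by
    rintro a b ⟨h1, h2⟩
    have h3 := hM _ h1
    have h4 := psi_psi (-m) (a⁻¹ * b)
    rw [neg_neg] at h4
    rw [h4] at h3
    rcases h3 with h3 | h3
    · exact (h2 (inv_mul_eq_one.mp h3)).elim
    · simpa using inv a _ _ h3
  funext a b
  apply propext
  refine ⟨fun h => ?_, key a b⟩
  have hab : a ≠ b := by rintro rfl; exact irr _ h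
  rcases (ord_left m).2.2.1 a b hab with h1 | h1
  · exact h1
  · exact (irr _ (tr _ _ _ h (key _ _ h1))).elim

lemma zc (j : ℤ) (g : Gp) : g * gz ^ j = gz ^ j * g := dat.zcomm j g

lemma no_conj {m m' : ℤ} (hm : m < m') (g : Gp)
    (h : ∀ k : Gp, psi m' k ∈ MM ↔ psi m (g⁻¹ * k * g) ∈ MM) : False := by
  set c := psi m g with hc
  obtain ⟨N1, hN1⟩ := cofinal c
  obtain ⟨N2, hN2⟩ := cofinal c⁻¹
  set n : ℕ := N1 + N2 + 1 with hn
  have hA : ∀ (m j : ℤ), psi m (gx ^ n * gz ^ j) = gx ^ n * gz ^ (j + m * n) := by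
    intro m j
    rw [map_mul, map_pow, map_zpow, psi_x, psi_z, Commute.mul_pow (zc m gx), ← zpow_natCast (gz ^ m),
      ← zpow_mul, mul_assoc, ← zpow_add, add_comm]
  have step : ∀ J : ℤ, gx ^ n * gz ^ J ∈ MM → gx ^ n * gz ^ (J - 1) ∈ MM := by
    intro J hJ
    have h1 : psi m' (gx ^ n * gz ^ (J - m' * n)) ∈ MM := by
      rw [hA]; simpa using hJ
    rw [h, map_mul, map_mul, map_inv, ← hc, hA] at h1
    have h2 := MM.mul_mem (MM.mul_mem (hN1 N1 le_rfl) h1) (hN2 N2 le_rfl)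
    have h3 : gz ^ (N1 : ℤ) * c * (c⁻¹ * (gx ^ n * gz ^ (J - m' * n + m * n)) * c) *
        (gz ^ (N2 : ℤ) * c⁻¹) = gx ^ n * gz ^ (N1 + N2 + (J - m' * n + m * n)) := by
      rw [← zc (N2 : ℤ) c⁻¹]
      calc _ = gz ^ (N1 : ℤ) * gx ^ n * gz ^ (J - m' * n + m * n) * gz ^ (N2 : ℤ) := by
            group
        _ = gx ^ n * (gz ^ (N1 : ℤ) * gz ^ (J - m' * n + m * n) * gz ^ (N2 : ℤ)) := by
            rw [← zc (N1 : ℤ) (gx ^ n)]; simp only [mul_assoc]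
        _ = _ := by
            rw [← zpow_add, ← zpow_add]; congr 2; ring
    rw [h3] at h2
    have hpos : 0 ≤ J - 1 - (N1 + N2 + (J - m' * n + m * n)) := by
      have : (n : ℤ) ≤ (m' - m) * n := by nlinarith
      have : (n : ℤ) = N1 + N2 + 1 := by rw [hn]; push_cast; ring
      nlinarith
    have h4 := MM.mul_mem h2 (z_pow_mem hpos)
    rw [mul_assoc, ← zpow_add] at h4
    convert h4 using 3
    ring
  have gxM : gx ∈ MM := dat.ha 0
  have all : ∀ i : ℕ, gx ^ n * gz ^ (-(i : ℤ)) ∈ MM := by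
    intro i
    induction i with
    | zero => simpa using MM.pow_mem gxM n
    | succ i ih =>
      have := step _ ih
      convert this using 3
      push_cast; ring
  have h5 := all n
  have h6 : (gx ^ n * gz ^ (-(n : ℤ)))⁻¹ ∈ MM := by
    have : (gx ^ n * gz ^ (-(n : ℤ)))⁻¹ = s2 ^ n := by
      rw [s2, Commute.mul_pow (gz_comm gx⁻¹)]
      group
    rw [this]
    exact MM.pow_mem (dat.ha 2) n
  have h7 := pointed _ h5 h6
  have h8 := congrArg (fun u : Gp => u.2.toAdd) h7
  simp [gx, gz] at h8

lemma conj_eq {m m' : ℤ} (g : Gp) (h : ord m' = fun x y => ord m (x * g) (y * g)) : m = m' := by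
  have key : ∀ k : Gp, psi m' k ∈ MM ↔ psi m (g⁻¹ * k * g) ∈ MM := by
    intro k
    by_cases hk : k = 1
    · subst hk; simp [MM.one_mem]
    · have h1 := congrFun (congrFun h 1) k
      have h2 : (psi m' (1⁻¹ * k) ∈ MM ∧ 1 ≠ k) =
        (psi m ((1 * g)⁻¹ * (k * g)) ∈ MM ∧ 1 * g ≠ k * g) := h1
      have h3 : (1 : Gp) ≠ k := Ne.symm hk
      have h4 : 1 * g ≠ k * g := fun e => h3 (mul_right_cancel e)
      rw [and_iff_left h3, and_iff_left h4, inv_one, one_mul, one_mul] at h2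
      rw [h2, mul_assoc]
  rcases lt_trichotomy m m' with hl | hl | hl
  · exact (no_conj hl g key).elim
  · exact hl
  · refine (no_conj hl g⁻¹ fun k => ?_).elim
    rw [key]
    congr! 2
    group

lemma ord_injective : Function.Injective ord := by
  intro m m' h
  apply conj_eq (1 : Gp)
  rw [← h]; simp

end concretePart

end F2Z

noncomputable section

/-- **Isolated left orders on `F₂ × ℤ`.**  The set of isolated points of `LO(F₂ × ℤ)` is
infinite, and there is an infinite family of isolated left orders on `F₂ × ℤ` which are
pairwise non-conjugate under the conjugation action `x <_g y ⇔ xg < yg`. -/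
theorem F2_times_Z_infinitely_many_isolated_left_orders :
    {r : FreeGroup (Fin 2) × Multiplicative ℤ → FreeGroup (Fin 2) × Multiplicative ℤ → Prop |
        IsLeftOrder r ∧ IsIsolatedLO r}.Infinite ∧
    ∃ T : Set (FreeGroup (Fin 2) × Multiplicative ℤ → FreeGroup (Fin 2) × Multiplicative ℤ → Prop),
      T.Infinite ∧
      (∀ r ∈ T, IsLeftOrder r ∧ IsIsolatedLO r) ∧
      (∀ r ∈ T, ∀ r' ∈ T, r ≠ r' →
        ∀ g : FreeGroup (Fin 2) × Multiplicative ℤ,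
          r' ≠ fun x y => r (x * g) (y * g)) := by
  have hT : (Set.range F2Z.ord).Infinite := Set.infinite_range_of_injective F2Z.ord_injective
  have hI : ∀ r ∈ Set.range F2Z.ord, IsLeftOrder r ∧ IsIsolatedLO r := by
    rintro _ ⟨m, rfl⟩
    exact ⟨F2Z.ord_left m, F2Z.ord_iso m⟩
  refine ⟨hT.mono hI, Set.range F2Z.ord, hT, hI, ?_⟩
  rintro _ ⟨m, rfl⟩ _ ⟨m', rfl⟩ hne g h
  exact hne (congrArg F2Z.ord (F2Z.conj_eq g h))

end
end

section
/- Let G be a countable group, c a circular order on G, and x₀ ∈ S¹. Then there exists a dynamical realization of c with basepoint x₀; that is, there exists a homomorphism ρ : G → Homeo₊(S¹) such that x₀ has trivial stabilizer under ρ, the circular order induced by the orbit of x₀ equals c, and for every homomorphism ρ' : G → Homeo₊(S¹) under which x₀ has trivial stabilizer and the orbit of x₀ induces c, there exists a continuous degree-one monotone map f : S¹ → S¹ with f(x₀) = x₀ and ρ(g) ∘ f = f ∘ ρ'(g) for all g ∈ G. -/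
noncomputable section

open Classical in
/-- The circle `ℝ/ℤ`. -/
abbrev S1 : Type := AddCircle (1 : ℝ)

/-- The canonical representative of a point of the circle in `[0,1)`. -/
noncomputable def S1.rep (x : S1) : ℝ := (AddCircle.equivIco 1 0 x : ℝ)

open Classical in
/-- The orientation cocycle on the circle: `1` on positively oriented (counterclockwise)
triples of pairwise distinct points, `-1` on negatively oriented ones, `0` otherwise. -/
noncomputable def circOrd (x y z : S1) : ℤ :=
  if x = y ∨ y = z ∨ x = z then 0
  else if (S1.rep x < S1.rep y ∧ S1.rep y < S1.rep z) ∨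
      (S1.rep y < S1.rep z ∧ S1.rep z < S1.rep x) ∨
      (S1.rep z < S1.rep x ∧ S1.rep x < S1.rep y) then 1 else -1

/-- The group `Homeo₊(S¹)` of orientation preserving homeomorphisms of the circle, realized
as the subgroup of bijections of `S¹` which are homeomorphisms and preserve the orientation
cocycle. -/
noncomputable def HomeoPos : Subgroup (Equiv.Perm S1) where
  carrier := {f | Continuous f ∧ Continuous f.symm ∧
    ∀ x y z, circOrd (f x) (f y) (f z) = circOrd x y z}
  one_mem' := ⟨by simpa using continuous_id, by exact continuous_id, by simp⟩
  mul_mem' := by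
    rintro a b ⟨ha1, ha2, ha3⟩ ⟨hb1, hb2, hb3⟩
    refine ⟨?_, ?_, ?_⟩
    · have : ⇑(a * b) = ⇑a ∘ ⇑b := by ext x; simp [Equiv.Perm.mul_apply]
      rw [this]; exact ha1.comp hb1
    · have : ⇑(a * b).symm = ⇑b.symm ∘ ⇑a.symm := by
        ext x; rfl
      rw [this]; exact hb2.comp ha2
    · intro x y z
      simp only [Equiv.Perm.mul_apply]
      rw [ha3, hb3]
  inv_mem' := by
    rintro a ⟨ha1, ha2, ha3⟩
    refine ⟨ha2, by exact ha1, ?_⟩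
    intro x y z
    have := ha3 (a⁻¹ x) (a⁻¹ y) (a⁻¹ z)
    simpa using this.symm

/-- The action of an element of `Homeo₊(S¹)` on the circle. -/
def ap (h : ↥HomeoPos) (x : S1) : S1 := h.1 x

lemma ap_one (x : S1) : ap 1 x = x := rfl

lemma ap_mul (h₁ h₂ : ↥HomeoPos) (x : S1) : ap (h₁ * h₂) x = ap h₁ (ap h₂ x) := rfl

variable {G : Type*} [Group G]

/-- A (left-invariant) circular order on a group `G`: a function `G³ → {-1,0,1}` vanishing
exactly on degenerate triples, satisfying the cocycle identity, and left-invariant. -/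
def IsCircularOrder (c : G → G → G → ℤ) : Prop :=
  (∀ a b d, c a b d = 0 ↔ a = b ∨ b = d ∨ a = d) ∧
  (∀ a b d, c a b d = 1 ∨ c a b d = 0 ∨ c a b d = -1) ∧
  (∀ g₁ g₂ g₃ g₄, c g₂ g₃ g₄ - c g₁ g₃ g₄ + c g₁ g₂ g₄ - c g₁ g₂ g₃ = 0) ∧
  (∀ g u v w, c (g * u) (g * v) (g * w) = c u v w)

/-- `c` is an isolated point of the space `CO(G)` of circular orders on `G` (with the
topology induced from the product topology on `{-1,0,1}^{G³}`): some basic neighborhood,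
determined by agreement on a finite subset of `G`, contains only `c`. -/
def IsIsolatedCO (c : G → G → G → ℤ) : Prop :=
  ∃ S : Finset G, ∀ c' : G → G → G → ℤ, IsCircularOrder c' →
    (∀ u ∈ S, ∀ v ∈ S, ∀ w ∈ S, c' u v w = c u v w) → c' = c

/-- The basepoint `x₀` has trivial stabilizer under the action `ρ`. -/
def TrivialStabilizer (ρ : G →* ↥HomeoPos) (x₀ : S1) : Prop :=
  ∀ g : G, ap (ρ g) x₀ = x₀ → g = 1

/-- The circular order on `G` induced by the orbit of a point `x₀` with trivial stabilizer. -/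
def inducedCO (ρ : G →* ↥HomeoPos) (x₀ : S1) (g₁ g₂ g₃ : G) : ℤ :=
  circOrd (ap (ρ g₁) x₀) (ap (ρ g₂) x₀) (ap (ρ g₃) x₀)

/-- A continuous degree-one monotone map of the circle: a continuous surjection which
weakly preserves the orientation cocycle. -/
def DegOneMonotone (f : S1 → S1) : Prop :=
  Continuous f ∧ Function.Surjective f ∧
    ∀ x y z, f x ≠ f y → f y ≠ f z → f x ≠ f z → circOrd (f x) (f y) (f z) = circOrd x y z

/-- `ρ` is a dynamical realization of the circular order `c` with basepoint `x₀`. -/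
def IsDynamicalRealization (ρ : G →* ↥HomeoPos) (x₀ : S1) (c : G → G → G → ℤ) : Prop :=
  TrivialStabilizer ρ x₀ ∧
  (∀ g₁ g₂ g₃, inducedCO ρ x₀ g₁ g₂ g₃ = c g₁ g₂ g₃) ∧
  ∀ ρ' : G →* ↥HomeoPos, TrivialStabilizer ρ' x₀ →
    (∀ g₁ g₂ g₃, inducedCO ρ' x₀ g₁ g₂ g₃ = c g₁ g₂ g₃) →
    ∃ f : S1 → S1, DegOneMonotone f ∧ f x₀ = x₀ ∧
      ∀ g : G, (ap (ρ g)) ∘ f = f ∘ (ap (ρ' g))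

end
noncomputable section
variable {G : Type*} [Group G]

def cyc3 (u v w : ℝ) : Prop := (u < v ∧ v < w) ∨ (v < w ∧ w < u) ∨ (w < u ∧ u < v)

lemma rep_nonneg (x : S1) : 0 ≤ S1.rep x := (AddCircle.equivIco 1 0 x).2.1

lemma rep_lt_one (x : S1) : S1.rep x < 1 := by
  have := (AddCircle.equivIco 1 0 x).2.2
  simpa [S1.rep] using this

lemma coe_rep (x : S1) : ((S1.rep x : ℝ) : S1) = x := AddCircle.coe_equivIco

lemma rep_coe (t : ℝ) (h0 : 0 ≤ t) (h1 : t < 1) : S1.rep (t : S1) = t :=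
  AddCircle.equivIco_coe_of_mem (p := (1 : ℝ)) (a := 0) ⟨h0, by simpa using h1⟩

lemma rep_inj {x y : S1} (h : S1.rep x = S1.rep y) : x = y := by
  rw [← coe_rep x, ← coe_rep y, h]

lemma rep_zero : S1.rep 0 = 0 := by
  simpa using rep_coe 0 le_rfl one_pos

lemma rep_eq_zero {x : S1} : S1.rep x = 0 ↔ x = 0 :=
  ⟨fun h => rep_inj (h.trans rep_zero.symm), fun h => by rw [h, rep_zero]⟩

lemma coe_add_int (t : ℝ) (n : ℤ) : ((t + n : ℝ) : S1) = t := by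
  have h : ((n : ℝ) : S1) = 0 := by
    rw [AddCircle.coe_eq_zero_iff]
    exact ⟨n, by simp⟩
  rw [AddCircle.coe_add, h, add_zero]

lemma coe_sub_one (t : ℝ) : ((t - 1 : ℝ) : S1) = t := by
  have := coe_add_int t (-1)
  simpa [sub_eq_add_neg] using this

lemma coe_add_one (t : ℝ) : ((t + 1 : ℝ) : S1) = t := by
  have := coe_add_int t 1
  simpa using this

lemma cyc3_of_circOrd {x y z : S1} (h : circOrd x y z = 1) :
    cyc3 (S1.rep x) (S1.rep y) (S1.rep z) := by
  unfold circOrd at h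
  by_cases h1 : x = y ∨ y = z ∨ x = z
  · rw [if_pos h1] at h; norm_num at h
  · rw [if_neg h1] at h
    by_contra h2
    unfold cyc3 at h2
    rw [if_neg h2] at h; norm_num at h

lemma circOrd_eq_one_iff {x y z : S1} :
    circOrd x y z = 1 ↔ cyc3 (S1.rep x) (S1.rep y) (S1.rep z) := by
  refine ⟨cyc3_of_circOrd, fun h => ?_⟩
  unfold circOrd
  unfold cyc3 at h
  rw [if_neg, if_pos h]
  rintro (rfl | rfl | rfl) <;> rcases h with h | h | h <;> linarith [h.1, h.2]

lemma circOrd_eq_zero_iff {x y z : S1} : circOrd x y z = 0 ↔ x = y ∨ y = z ∨ x = z := by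
  unfold circOrd
  split_ifs with h1 h2 <;> simp [h1]

lemma circOrd_eq_neg_one_iff {x y z : S1} : circOrd x y z = -1 ↔ circOrd x z y = 1 := by
  rw [circOrd_eq_one_iff]
  constructor
  · intro h
    unfold circOrd at h
    split_ifs at h with h1 h2
    push Not at h1
    have hxy : S1.rep x ≠ S1.rep y := fun h => h1.1 (rep_inj h)
    have hyz : S1.rep y ≠ S1.rep z := fun h => h1.2.1 (rep_inj h)
    have hxz : S1.rep x ≠ S1.rep z := fun h => h1.2.2 (rep_inj h)
    unfold cyc3
    rcases lt_or_gt_of_ne hxy with h | h <;> rcases lt_or_gt_of_ne hyz with h' | h' <;>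
    rcases lt_or_gt_of_ne hxz with h'' | h'' <;> simp_all <;> linarith
  · intro h
    unfold circOrd
    rw [if_neg, if_neg]
    · rintro (h' | h' | h') <;> rcases h with h | h | h <;> linarith [h.1, h.2, h'.1, h'.2]
    · rintro (rfl | rfl | rfl) <;> rcases h with h | h | h <;> linarith [h.1, h.2]

lemma circOrd_rot {x y z : S1} (h : circOrd x y z = 1) : circOrd y z x = 1 := by
  rw [circOrd_eq_one_iff] at *
  rcases h with h | h | h
  · exact Or.inr (Or.inr h)
  · exact Or.inl h
  · exact Or.inr (Or.inl h)

lemma circOrd_rot_eq (x y z : S1) : circOrd y z x = circOrd x y z := by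
  have key : ∀ x y z : S1, circOrd x y z = 1 ∨ circOrd x y z = 0 ∨ circOrd x y z = -1 := by
    intro x y z; unfold circOrd; split_ifs <;> simp
  rcases key x y z with h | h | h
  · rw [h, circOrd_rot h]
  · rw [h]; rw [circOrd_eq_zero_iff] at *; grind
  · rw [h]; rw [circOrd_eq_neg_one_iff] at *; exact circOrd_rot (circOrd_rot h)

lemma circOrd_asymm {x y z : S1} (h : circOrd x y z = 1) (h' : circOrd x z y = 1) : False := by
  rw [← circOrd_eq_neg_one_iff] at h'; rw [h] at h'; norm_num at h'

lemma circOrd_ne {x y z : S1} (h : circOrd x y z = 1) : x ≠ y ∧ y ≠ z ∧ x ≠ z := by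
  have : ¬ (circOrd x y z = 0) := by rw [h]; norm_num
  rw [circOrd_eq_zero_iff] at this
  tauto

lemma circOrd_total {x y z : S1} (h1 : x ≠ y) (h2 : y ≠ z) (h3 : x ≠ z) :
    circOrd x y z = 1 ∨ circOrd x z y = 1 := by
  rw [← circOrd_eq_neg_one_iff (x := x) (y := y) (z := z)]
  have : ¬ (circOrd x y z = 0) := by
    rw [circOrd_eq_zero_iff]; tauto
  have key : circOrd x y z = 1 ∨ circOrd x y z = 0 ∨ circOrd x y z = -1 := by
    unfold circOrd; split_ifs <;> simp
  tauto

/-- two triples have same orientation as soon as implications hold -/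
lemma circOrd_congr {x y z x' y' z' : S1} (h1 : circOrd x y z = 1 ↔ circOrd x' y' z' = 1)
    (h2 : circOrd x z y = 1 ↔ circOrd x' z' y' = 1) : circOrd x y z = circOrd x' y' z' := by
  rw [← circOrd_eq_neg_one_iff, ← circOrd_eq_neg_one_iff] at h2
  have key : ∀ x y z : S1, circOrd x y z = 1 ∨ circOrd x y z = 0 ∨ circOrd x y z = -1 := by
    intro x y z; unfold circOrd; split_ifs <;> simp
  have := key x y z
  have := key x' y' z'
  omega

lemma circOrd_of_lift {u v w : ℝ} (h1 : u < v) (h2 : v < w) (h3 : w < u + 1) :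
    circOrd (u : S1) (v : S1) (w : S1) = 1 := by
  rw [circOrd_eq_one_iff]
  have e : ∀ t : ℝ, ((t - ⌊u⌋ : ℝ) : S1) = t := by
    intro t
    have := coe_add_int t (-⌊u⌋)
    simpa [sub_eq_add_neg] using this
  rw [← e u, ← e v, ← e w]
  have hu0 : 0 ≤ u - ⌊u⌋ := by linarith [Int.floor_le u]
  have hu1 : u - ⌊u⌋ < 1 := by linarith [Int.lt_floor_add_one u]
  generalize (⌊u⌋ : ℝ) = n at *
  rw [rep_coe (u - n) hu0 hu1]
  unfold cyc3
  by_cases hv : v - n < 1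
  · rw [rep_coe (v - n) (by linarith) hv]
    by_cases hw : w - n < 1
    · rw [rep_coe (w - n) (by linarith) hw]
      left; constructor <;> linarith
    · rw [← coe_sub_one (w - n), rep_coe (w - n - 1) (by linarith) (by linarith)]
      right; right; constructor <;> linarith
  · rw [← coe_sub_one (v - n), rep_coe (v - n - 1) (by linarith) (by linarith)]
    rw [← coe_sub_one (w - n), rep_coe (w - n - 1) (by linarith) (by linarith)]
    right; left; constructor <;> linarith

lemma exists_lift {x y z : S1} (h : circOrd x y z = 1) :
    ∃ u v w : ℝ, u < v ∧ v < w ∧ w < u + 1 ∧ (u : S1) = x ∧ (v : S1) = y ∧ (w : S1) = z := by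
  rw [circOrd_eq_one_iff] at h
  have := rep_nonneg x; have := rep_nonneg y; have := rep_nonneg z
  have := rep_lt_one x; have := rep_lt_one y; have := rep_lt_one z
  rcases h with h | h | h
  · exact ⟨_, _, _, h.1, h.2, by linarith, coe_rep x, coe_rep y, coe_rep z⟩
  · exact ⟨S1.rep x - 1, _, _, by linarith, h.1, by linarith [h.2],
      by rw [coe_sub_one, coe_rep], coe_rep y, coe_rep z⟩
  · exact ⟨_, _, S1.rep z + 1, h.2, by linarith, by linarith [h.1], coe_rep x, coe_rep y,
      by rw [coe_add_one, coe_rep]⟩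

lemma circOrd_add_one {x y z : S1} (a : S1) (h : circOrd x y z = 1) :
    circOrd (x + a) (y + a) (z + a) = 1 := by
  obtain ⟨u, v, w, h1, h2, h3, rfl, rfl, rfl⟩ := exists_lift h
  rw [← coe_rep a, ← AddCircle.coe_add, ← AddCircle.coe_add, ← AddCircle.coe_add]
  exact circOrd_of_lift (by linarith) (by linarith) (by linarith)

lemma circOrd_add_iff {x y z : S1} (a : S1) :
    circOrd (x + a) (y + a) (z + a) = 1 ↔ circOrd x y z = 1 := by
  refine ⟨fun h => ?_, circOrd_add_one a⟩
  have := circOrd_add_one (-a) h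
  simpa using this

lemma circOrd_iff_base (a : S1) {x y z : S1} : circOrd x y z = 1 ↔
    cyc3 (S1.rep (x - a)) (S1.rep (y - a)) (S1.rep (z - a)) := by
  rw [← circOrd_eq_one_iff, sub_eq_add_neg, sub_eq_add_neg, sub_eq_add_neg, circOrd_add_iff]

lemma rep_sub_lt_iff (a : S1) {y z : S1} : S1.rep (y - a) < S1.rep (z - a) ↔
    (y = a ∧ z ≠ a) ∨ circOrd a y z = 1 := by
  rw [circOrd_iff_base a, sub_self, rep_zero]
  have h1 := rep_nonneg (y - a)
  have h2 := rep_nonneg (z - a)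
  have e1 : S1.rep (y - a) = 0 ↔ y = a := by rw [rep_eq_zero, sub_eq_zero]
  have e2 : S1.rep (z - a) = 0 ↔ z = a := by rw [rep_eq_zero, sub_eq_zero]
  unfold cyc3
  rw [← e1, ne_eq, ← e2]
  generalize S1.rep (y - a) = p at *
  generalize S1.rep (z - a) = q at *
  constructor
  · intro h
    rcases h1.eq_or_lt with h' | h'
    · left; exact ⟨h'.symm, by linarith⟩
    · right; left; exact ⟨h', h⟩
  · rintro (⟨h, h'⟩ | h | h | h)
    · rw [h]; exact lt_of_le_of_ne h2 (Ne.symm h')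
    · exact h.2
    · linarith [h.2]
    · linarith [h.1]

lemma circOrd_trans {x y z w : S1} (h : circOrd x y z = 1) (h' : circOrd x z w = 1) :
    circOrd x y w = 1 ∧ circOrd y z w = 1 := by
  have a1 := (rep_sub_lt_iff x).2 (Or.inr h)
  have a2 := (rep_sub_lt_iff x).2 (Or.inr h')
  constructor
  · rcases (rep_sub_lt_iff x).1 (a1.trans a2) with h'' | h''
    · exact absurd h''.1.symm (circOrd_ne h).1
    · exact h''
  · rw [circOrd_iff_base x]; exact Or.inl ⟨a1, a2⟩

/-! ### Degree one maps -/

lemma weak_of_one {f : S1 → S1}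
    (h : ∀ x y z, f x ≠ f y → f y ≠ f z → f x ≠ f z → circOrd x y z = 1 →
      circOrd (f x) (f y) (f z) = 1) :
    ∀ x y z, f x ≠ f y → f y ≠ f z → f x ≠ f z → circOrd (f x) (f y) (f z) = circOrd x y z := by
  intro x y z h1 h2 h3
  rcases circOrd_total (x := x) (y := y) (z := z) (fun e => h1 (by rw [e]))
    (fun e => h2 (by rw [e])) (fun e => h3 (by rw [e])) with h' | h'
  · rw [h', h x y z h1 h2 h3 h']
  · have := h x z y h3 h2.symm h1 h'
    rw [← circOrd_eq_neg_one_iff] at h' this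
    rw [h', this]

lemma exists_lift_near (p : ℝ) (y : S1) : ∃ t : ℝ, p ≤ t ∧ t < p + 1 ∧ (t : S1) = y := by
  refine ⟨p + S1.rep (y - p), by linarith [rep_nonneg (y - p)], by linarith [rep_lt_one (y - p)], ?_⟩
  rw [AddCircle.coe_add, coe_rep]; abel

lemma coe_continuous : Continuous (fun t : ℝ => (t : S1)) := AddCircle.continuous_mk' 1

lemma isOpen_coe_image {U : Set ℝ} (h : IsOpen U) : IsOpen ((fun t : ℝ => (t : S1)) '' U) :=
  QuotientAddGroup.isOpenMap_coe U h

lemma degOne_of_dense {f : S1 → S1} (hd : DenseRange f)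
    (hm : ∀ x y z, f x ≠ f y → f y ≠ f z → f x ≠ f z → circOrd (f x) (f y) (f z) = circOrd x y z) :
    DegOneMonotone f := by
  have hcont : Continuous f := by
    rw [continuous_iff_continuousAt]
    intro y U hU
    obtain ⟨v, hv⟩ : ∃ v : ℝ, (v : S1) = f y := ⟨_, coe_rep _⟩
    have hU' : (fun t : ℝ => (t : S1)) ⁻¹' U ∈ nhds v := by
      apply coe_continuous.continuousAt
      show U ∈ nhds (v : S1)
      rw [hv]; exact hU
    obtain ⟨ε, hε, hb⟩ := Metric.mem_nhds_iff.1 hU'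
    set δ := min ε (1/2) with hδ
    have hδ0 : 0 < δ := by positivity
    have hδ1 : δ ≤ 1/2 := min_le_right _ _
    have hδ2 : δ ≤ ε := min_le_left _ _
    obtain ⟨y1, p, hp, hpy⟩ := hd.exists_mem_open
      (isOpen_coe_image (isOpen_Ioo (a := v - δ) (b := v)))
      ⟨_, v - δ/2, ⟨by linarith, by linarith⟩, rfl⟩
    obtain ⟨y2, q, hq, hqy⟩ := hd.exists_mem_open
      (isOpen_coe_image (isOpen_Ioo (a := v) (b := v + δ)))
      ⟨_, v + δ/2, ⟨by linarith, by linarith⟩, rfl⟩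
    simp only at hpy hqy
    have h1 : circOrd (f y1) (f y) (f y2) = 1 := by
      rw [← hpy, ← hqy, ← hv]
      exact circOrd_of_lift hp.2 hq.1 (by linarith [hp.1, hq.2])
    have hne := circOrd_ne h1
    rw [hm _ _ _ hne.1 hne.2.1 hne.2.2] at h1
    obtain ⟨u, v', w, a1, a2, a3, rfl, rfl, rfl⟩ := exists_lift h1
    have hN : (fun t : ℝ => (t : S1)) '' Set.Ioo u w ∈ nhds (v' : S1) :=
      (isOpen_coe_image isOpen_Ioo).mem_nhds ⟨v', ⟨a1, a2⟩, rfl⟩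
    rw [Filter.mem_map]
    refine Filter.mem_of_superset hN ?_
    rintro _ ⟨r, hr, rfl⟩
    have h2 : circOrd (u : S1) (r : S1) (w : S1) = 1 := circOrd_of_lift hr.1 hr.2 a3
    obtain ⟨t, t1, t2, t3⟩ := exists_lift_near p (f r)
    have htq : t ≤ q := by
      by_contra hcon
      push Not at hcon
      have t1' : p < t := by linarith [hp.2, hq.1]
      have h3 : circOrd (f w) (f r) (f u) = 1 := by
        rw [← hpy, ← hqy, ← t3, ← coe_add_one p]
        exact circOrd_of_lift hcon t2 (by linarith [hp.2, hq.1])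
      have hne := circOrd_ne h3
      rw [hm _ _ _ hne.1 hne.2.1 hne.2.2] at h3
      exact circOrd_asymm (circOrd_rot h2) (circOrd_rot h3)
    show f r ∈ U
    rw [← t3]
    apply hb
    rw [Metric.mem_ball, Real.dist_eq, abs_lt]
    constructor <;> linarith [hp.1, hq.2]
  refine ⟨hcont, ?_, hm⟩
  have : IsClosed (Set.range f) := (isCompact_range hcont).isClosed
  rw [← Set.range_eq_univ, ← this.closure_eq]
  exact hd.closure_range

lemma degOne_comp {f g : S1 → S1} (hf : DegOneMonotone f) (hg : DegOneMonotone g) :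
    DegOneMonotone (f ∘ g) := by
  refine ⟨hf.1.comp hg.1, hf.2.1.comp hg.2.1, ?_⟩
  intro x y z h1 h2 h3
  simp only [Function.comp] at *
  rw [hf.2.2 _ _ _ h1 h2 h3]
  exact hg.2.2 _ _ _ (fun e => h1 (by rw [e])) (fun e => h2 (by rw [e])) (fun e => h3 (by rw [e]))

lemma degOne_ap (h : ↥HomeoPos) : DegOneMonotone (ap h) :=
  ⟨h.2.1, h.1.surjective, fun x y z _ _ _ => h.2.2.2 x y z⟩

lemma exists_between_dense {X : Type*} {i : X → S1} (hd : DenseRange i) {a b : S1} (h : a ≠ b) :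
    ∃ x, circOrd a (i x) b = 1 := by
  obtain ⟨u, hu⟩ : ∃ u : ℝ, (u : S1) = a := ⟨_, coe_rep _⟩
  obtain ⟨w, w1, w2, w3⟩ := exists_lift_near u b
  have : u < w := lt_of_le_of_ne w1 (by rintro rfl; exact h (hu.symm.trans w3))
  obtain ⟨x, t, ht, htx⟩ := hd.exists_mem_open
      (isOpen_coe_image (isOpen_Ioo (a := u) (b := w)))
      ⟨_, (u + w)/2, ⟨by linarith, by linarith⟩, rfl⟩
  refine ⟨x, ?_⟩
  simp only at htx
  rw [← htx, ← hu, ← w3]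
  exact circOrd_of_lift ht.1 ht.2 w2

lemma degOne_unique {X : Type*} {i j : X → S1} (hd : DenseRange i) {f1 f2 : S1 → S1}
    (h1 : DegOneMonotone f1) (h2 : DegOneMonotone f2)
    (e1 : ∀ x, f1 (j x) = i x) (e2 : ∀ x, f2 (j x) = i x) : f1 = f2 := by
  funext y
  by_contra hne
  obtain ⟨x, hx⟩ := exists_between_dense hd hne
  obtain ⟨z, hz⟩ := exists_between_dense hd (Ne.symm hne)
  have a1 : circOrd (f1 y) (i x) (i z) = 1 :=
    (circOrd_trans hx (circOrd_rot (circOrd_rot hz))).1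
  have a2 : circOrd (f2 y) (i z) (i x) = 1 :=
    (circOrd_trans hz (circOrd_rot (circOrd_rot hx))).1
  have n1 := circOrd_ne a1
  have n2 := circOrd_ne a2
  rw [← e1 x, ← e1 z] at a1 n1
  rw [← e2 x, ← e2 z] at a2 n2
  rw [h1.2.2 _ _ _ n1.1 n1.2.1 n1.2.2] at a1
  rw [h2.2.2 _ _ _ n2.1 n2.2.1 n2.2.2] at a2
  exact circOrd_asymm a1 a2

lemma degOne_exists {X : Type*} {i j : X → S1} (hd : DenseRange i) (hi : Function.Injective i)
    (hj : Function.Injective j) (xs : X)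
    (h : ∀ x y z, circOrd (i x) (i y) (i z) = circOrd (j x) (j y) (j z)) :
    ∃ f, DegOneMonotone f ∧ ∀ x, f (j x) = i x := by
  set a := j xs with ha
  set b := i xs with hb
  have hlt : ∀ x y, S1.rep (i x - b) < S1.rep (i y - b) → S1.rep (j x - a) < S1.rep (j y - a) := by
    intro x y hxy
    rw [rep_sub_lt_iff] at *
    rcases hxy with ⟨h1, h2⟩ | h1
    · left
      refine ⟨by rw [hi h1], fun e => h2 (by rw [hj e])⟩
    · right; rw [ha, ← h]; exact h1
  let A : S1 → Set ℝ := fun y => {r | ∃ x, S1.rep (j x - a) ≤ S1.rep (y - a) ∧ r = S1.rep (i x - b)}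
  have hA1 : ∀ y, ∀ r ∈ A y, r ≤ 1 := by
    rintro y _ ⟨x, _, rfl⟩; exact (rep_lt_one _).le
  have hAb : ∀ y, BddAbove (A y) := fun y => ⟨1, hA1 y⟩
  have hA0 : ∀ y, (0 : ℝ) ∈ A y := fun y =>
    ⟨xs, by rw [← ha, sub_self, rep_zero]; exact rep_nonneg _, by rw [← hb, sub_self, rep_zero]⟩
  let F : S1 → ℝ := fun y => sSup (A y)
  have hF0 : ∀ y, 0 ≤ F y := fun y => le_csSup (hAb y) (hA0 y)
  have hF1 : ∀ y, F y ≤ 1 := fun y => csSup_le ⟨0, hA0 y⟩ (hA1 y)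
  have hFm : ∀ y z, S1.rep (y - a) ≤ S1.rep (z - a) → F y ≤ F z := by
    intro y z hyz
    apply csSup_le_csSup (hAb z) ⟨0, hA0 y⟩
    rintro r ⟨x, hx, rfl⟩
    exact ⟨x, hx.trans hyz, rfl⟩
  have hFj : ∀ x, F (j x) = S1.rep (i x - b) := by
    intro x
    apply le_antisymm
    · apply csSup_le ⟨0, hA0 _⟩
      rintro r ⟨x', hx', rfl⟩
      by_contra hcon
      push Not at hcon
      exact absurd (hlt _ _ hcon) (not_lt.2 hx')
    · exact le_csSup (hAb _) ⟨x, le_rfl, rfl⟩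
  let f : S1 → S1 := fun y => (F y : S1) + b
  have hfj : ∀ x, f (j x) = i x := by
    intro x
    show (F (j x) : S1) + b = i x
    rw [hFj, coe_rep]; abel
  refine ⟨f, degOne_of_dense ?_ (weak_of_one ?_), hfj⟩
  · refine hd.mono ?_
    rintro _ ⟨x, rfl⟩
    exact ⟨j x, hfj x⟩
  · have key : ∀ x y z, f x ≠ f y → f y ≠ f z → f x ≠ f z →
        S1.rep (x - a) < S1.rep (y - a) → S1.rep (y - a) < S1.rep (z - a) →
        circOrd (f x) (f y) (f z) = 1 := by
      intro x y z h1 h2 h3 l1 l2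
      have m1 := lt_of_le_of_ne (hFm _ _ l1.le) (fun e => h1 (by simp only [f]; rw [e]))
      have m2 := lt_of_le_of_ne (hFm _ _ l2.le) (fun e => h2 (by simp only [f]; rw [e]))
      have m3 : F z < F x + 1 := by
        refine lt_of_le_of_ne (by linarith [hF1 z, hF0 x]) (fun e => h3 ?_)
        simp only [f]; rw [e, coe_add_one]
      exact circOrd_add_one b (circOrd_of_lift m1 m2 m3)
    intro x y z h1 h2 h3 hxyz
    rw [circOrd_iff_base a] at hxyz
    rcases hxyz with l | l | l
    · exact key x y z h1 h2 h3 l.1 l.2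
    · exact circOrd_rot (circOrd_rot (key y z x h2 h3.symm h1.symm l.1 l.2))
    · exact circOrd_rot (key z x y h3.symm h1 h2.symm l.1 l.2)

lemma exists_dense_model {X : Type*} [Countable X] (xs : X) (j : X → S1)
    (hj : Function.Injective j) (hne : ∃ x, x ≠ xs)
    (hd : ∀ x y, x ≠ y → ∃ z, circOrd (j x) (j z) (j y) = 1) (x₀ : S1) :
    ∃ i : X → S1, Function.Injective i ∧ DenseRange i ∧ i xs = x₀ ∧
      ∀ x y z, circOrd (i x) (i y) (i z) = circOrd (j x) (j y) (j z) := by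
  classical
  let r : X → ℝ := fun x => S1.rep (j x - j xs)
  have hr0 : r xs = 0 := by simp only [r]; rw [sub_self, rep_zero]
  have hrinj : Function.Injective r := by
    intro x y hxy
    exact hj (sub_left_injective (rep_inj hxy))
  have hrpos : ∀ x, x ≠ xs → 0 < r x := fun x hx =>
    lt_of_le_of_ne (rep_nonneg _) (fun e => hx (hrinj (by rw [hr0]; exact e.symm)))
  let D : Set ℝ := r '' {x | x ≠ xs}
  haveI : Countable D := (Set.to_countable {x : X | x ≠ xs}).image r |>.to_subtype
  haveI : Nonempty D := by
    obtain ⟨x, hx⟩ := hne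
    exact ⟨⟨r x, x, hx, rfl⟩⟩
  have hcyc : ∀ x y z, circOrd (j x) (j y) (j z) = 1 ↔ cyc3 (r x) (r y) (r z) :=
    fun x y z => circOrd_iff_base (j xs)
  haveI : DenselyOrdered D := by
    constructor
    rintro ⟨_, x, hx, rfl⟩ ⟨_, y, hy, rfl⟩ hxy
    have hxy : r x < r y := hxy
    obtain ⟨z, hz⟩ := hd x y (by rintro rfl; exact lt_irrefl _ hxy)
    rw [hcyc] at hz
    have hz' : r x < r z ∧ r z < r y := by
      rcases hz with hz | hz | hz
      · exact hz
      · linarith [hz.1, hz.2]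
      · linarith [hz.1, hz.2]
    refine ⟨⟨r z, z, ?_, rfl⟩, hz'.1, hz'.2⟩
    rintro rfl
    linarith [hz'.1, hrpos x hx]
  haveI : NoMinOrder D := by
    constructor
    rintro ⟨_, x, hx, rfl⟩
    obtain ⟨z, hz⟩ := hd xs x (Ne.symm hx)
    rw [hcyc, hr0] at hz
    have h0 : 0 ≤ r z := rep_nonneg _
    have hx0 := hrpos x hx
    have hz' : 0 < r z ∧ r z < r x := by
      rcases hz with hz | hz | hz
      · exact hz
      · linarith [hz.1, hz.2]
      · linarith [hz.1, hz.2]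
    refine ⟨⟨r z, z, ?_, rfl⟩, hz'.2⟩
    rintro rfl
    linarith [hz'.1]
  haveI : NoMaxOrder D := by
    constructor
    rintro ⟨_, x, hx, rfl⟩
    obtain ⟨z, hz⟩ := hd x xs hx
    rw [hcyc, hr0] at hz
    have h0 : 0 ≤ r z := rep_nonneg _
    have hx0 := hrpos x hx
    have hz' : r x < r z := by
      rcases hz with hz | hz | hz
      · linarith [hz.1, hz.2]
      · linarith [hz.1, hz.2]
      · exact hz.2
    refine ⟨⟨r z, z, ?_, rfl⟩, hz'⟩
    rintro rfl
    linarith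
  haveI : Nonempty (Set.Ioo (0 : ℚ) 1) := ⟨⟨1/2, by norm_num, by norm_num⟩⟩
  obtain ⟨φ⟩ := Order.iso_of_countable_dense D (Set.Ioo (0 : ℚ) 1)
  let r' : X → ℝ := fun x => if h : x = xs then 0 else (((φ ⟨r x, x, h, rfl⟩ : Set.Ioo (0:ℚ) 1) : ℚ) : ℝ)
  have hr'0 : r' xs = 0 := by simp [r']
  have hr'x : ∀ x (h : x ≠ xs), r' x = (((φ ⟨r x, x, h, rfl⟩ : Set.Ioo (0:ℚ) 1) : ℚ) : ℝ) := by
    intro x h; simp [r', h]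
  have hr'pos : ∀ x, x ≠ xs → 0 < r' x := by
    intro x h; rw [hr'x x h]
    exact_mod_cast (φ ⟨r x, x, h, rfl⟩).2.1
  have hr'nn : ∀ x, 0 ≤ r' x := by
    intro x
    by_cases h : x = xs
    · rw [h, hr'0]
    · exact (hr'pos x h).le
  have hr'lt : ∀ x, r' x < 1 := by
    intro x
    by_cases h : x = xs
    · rw [h, hr'0]; exact one_pos
    · rw [hr'x x h]
      exact_mod_cast (φ ⟨r x, x, h, rfl⟩).2.2
  have hiff : ∀ x y, r' x < r' y ↔ r x < r y := by
    intro x y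
    by_cases hx : x = xs
    · by_cases hy : y = xs
      · rw [hx, hy]; simp
      · rw [hx, hr0, hr'0]; exact ⟨fun _ => hrpos y hy, fun _ => hr'pos y hy⟩
    · by_cases hy : y = xs
      · rw [hy, hr0, hr'0]
        exact ⟨fun h => absurd h (not_lt.2 (hr'nn x)), fun h => absurd h (not_lt.2 (hrpos x hx).le)⟩
      · rw [hr'x x hx, hr'x y hy]
        rw [Rat.cast_lt, Subtype.coe_lt_coe, φ.lt_iff_lt]; exact Iff.rfl
  have hr'inj : Function.Injective r' := by
    intro x y hxy
    apply hrinj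
    have h1 := hiff x y
    have h2 := hiff y x
    rw [hxy] at h1 h2
    simp only [lt_irrefl, false_iff, not_lt] at h1 h2
    exact le_antisymm h2 h1
  have hrep : ∀ x, S1.rep (((r' x : ℝ) : S1)) = r' x := fun x => rep_coe _ (hr'nn x) (hr'lt x)
  refine ⟨fun x => (r' x : S1) + x₀, ?_, ?_, ?_, ?_⟩
  · intro x y hxy
    have := add_right_cancel hxy
    apply hr'inj
    rw [← hrep x, ← hrep y, this]
  · rw [DenseRange, dense_iff_inter_open]
    rintro U hU ⟨y, hy⟩
    let V : Set ℝ := (fun t : ℝ => (t : S1) + x₀) ⁻¹' U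
    have hV : IsOpen V := hU.preimage (coe_continuous.add continuous_const)
    have h1 : S1.rep (y - x₀) ∈ V := by
      show ((S1.rep (y - x₀) : ℝ) : S1) + x₀ ∈ U
      rw [coe_rep]; simpa using hy
    have h2 : S1.rep (y - x₀) ∈ closure (Set.Ioo (0:ℝ) 1) := by
      rw [closure_Ioo (by norm_num)]
      exact ⟨rep_nonneg _, (rep_lt_one _).le⟩
    have h3 : (V ∩ Set.Ioo 0 1).Nonempty := mem_closure_iff.1 h2 V hV h1
    obtain ⟨q, hq1, hq2⟩ := Rat.denseRange_cast (𝕜 := ℝ) |>.exists_mem_open (hV.inter isOpen_Ioo) h3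
    have hq : q ∈ Set.Ioo (0:ℚ) 1 := ⟨by exact_mod_cast hq2.1, by exact_mod_cast hq2.2⟩
    obtain ⟨⟨_, x, hx, rfl⟩, hφ⟩ := φ.surjective ⟨q, hq⟩
    refine ⟨_, ?_, ⟨x, rfl⟩⟩
    show ((r' x : ℝ) : S1) + x₀ ∈ U
    rw [hr'x x hx, hφ]
    exact hq1
  · simp [hr'0]
  · have : ∀ x y z, circOrd ((r' x : S1) + x₀) ((r' y : S1) + x₀) ((r' z : S1) + x₀) = 1 ↔
        circOrd (j x) (j y) (j z) = 1 := by
      intro x y z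
      rw [circOrd_add_iff, hcyc, circOrd_eq_one_iff, hrep, hrep, hrep]
      unfold cyc3
      simp only [hiff]
    intro x y z
    exact circOrd_congr (this x y z) (this x z y)

theorem realize {X : Type*} [Countable X] (act : G → X → X) (act_one : ∀ x, act 1 x = x)
    (act_mul : ∀ g h x, act (g * h) x = act g (act h x)) (xs : X) (j : X → S1)
    (hj : Function.Injective j) (hne : ∃ x, x ≠ xs)
    (hd : ∀ x y, x ≠ y → ∃ z, circOrd (j x) (j z) (j y) = 1)
    (hinv : ∀ g x y z, circOrd (j (act g x)) (j (act g y)) (j (act g z)) =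
      circOrd (j x) (j y) (j z)) (x₀ : S1) :
    ∃ i : X → S1, Function.Injective i ∧ i xs = x₀ ∧
      (∀ x y z, circOrd (i x) (i y) (i z) = circOrd (j x) (j y) (j z)) ∧
      ∃ ρ : G →* ↥HomeoPos, (∀ g x, ap (ρ g) (i x) = i (act g x)) ∧
        ∀ (ρ' : G →* ↥HomeoPos) (j' : X → S1), Function.Injective j' →
          (∀ x y z, circOrd (j' x) (j' y) (j' z) = circOrd (j x) (j y) (j z)) →
          (∀ g x, ap (ρ' g) (j' x) = j' (act g x)) →
          ∃ f, DegOneMonotone f ∧ (∀ x, f (j' x) = i x) ∧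
            ∀ g : G, (ap (ρ g)) ∘ f = f ∘ (ap (ρ' g)) := by
  obtain ⟨i, hi, hdi, hi0, hij⟩ := exists_dense_model xs j hj hne hd x₀
  have act_inj : ∀ g, Function.Injective (act g) := by
    intro g x y hxy
    have := congrArg (act g⁻¹) hxy
    simpa [← act_mul, act_one] using this
  have hex : ∀ g, ∃ f, DegOneMonotone f ∧ ∀ x, f (i (act g⁻¹ x)) = i x := by
    intro g
    apply degOne_exists (i := i) (j := fun x => i (act g⁻¹ x)) hdi hi (hi.comp (act_inj _)) xs
    intro x y z
    rw [hij, hij, hinv]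
  choose F hF1 hF2 using hex
  have hF3 : ∀ g x, F g (i x) = i (act g x) := by
    intro g x
    have := hF2 g (act g x)
    rwa [← act_mul, inv_mul_cancel, act_one] at this
  have hmul : ∀ g h, F (g * h) = F g ∘ F h := by
    intro g h
    refine degOne_unique (i := i) (j := fun x => i (act (g * h)⁻¹ x)) hdi (hF1 _)
      (degOne_comp (hF1 g) (hF1 h)) (hF2 _) ?_
    intro x
    simp only [Function.comp, hF3, ← act_mul]
    rw [← mul_assoc, mul_inv_cancel, act_one]
  have hid : DegOneMonotone (id : S1 → S1) :=
    ⟨continuous_id, Function.surjective_id, fun _ _ _ _ _ _ => rfl⟩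
  have hone : F 1 = id := by
    refine degOne_unique (i := i) (j := i) hdi (hF1 _) hid ?_ (fun _ => rfl)
    intro x; rw [hF3, act_one]
  have hinv1 : ∀ g y, F g⁻¹ (F g y) = y := by
    intro g y
    have := congrFun (hmul g⁻¹ g) y
    rw [inv_mul_cancel, hone] at this
    exact this.symm
  have hinv2 : ∀ g y, F g (F g⁻¹ y) = y := by
    intro g y
    have := hinv1 g⁻¹ y
    rwa [inv_inv] at this
  let P : G → Equiv.Perm S1 := fun g => ⟨F g, F g⁻¹, hinv1 g, hinv2 g⟩
  have hP : ∀ g, P g ∈ HomeoPos := by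
    intro g
    refine ⟨(hF1 g).1, (hF1 g⁻¹).1, ?_⟩
    intro x y z
    have hinj : Function.Injective (P g) := (P g).injective
    by_cases hxyz : x = y ∨ y = z ∨ x = z
    · rw [circOrd_eq_zero_iff.2 hxyz, circOrd_eq_zero_iff]
      rcases hxyz with rfl | rfl | rfl <;> simp
    · push Not at hxyz
      exact (hF1 g).2.2 x y z (hinj.ne hxyz.1) (hinj.ne hxyz.2.1) (hinj.ne hxyz.2.2)
  let ρ : G →* ↥HomeoPos :=
    { toFun := fun g => ⟨P g, hP g⟩
      map_one' := by
        apply Subtype.ext; apply Equiv.ext; intro x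
        exact congrFun hone x
      map_mul' := by
        intro g h
        apply Subtype.ext; apply Equiv.ext; intro x
        exact congrFun (hmul g h) x }
  have hρ : ∀ g y, ap (ρ g) y = F g y := fun _ _ => rfl
  refine ⟨i, hi, hi0, hij, ρ, fun g x => by rw [hρ, hF3], ?_⟩
  intro ρ' j' hj' hj'j heq
  obtain ⟨f, hf1, hf2⟩ := degOne_exists (i := i) (j := j') hdi hi hj' xs
    (fun x y z => by rw [hij, hj'j])
  refine ⟨f, hf1, hf2, ?_⟩
  intro g
  refine degOne_unique (i := fun x => i (act g x)) (j := j') ?_ (degOne_comp (degOne_ap _) hf1)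
    (degOne_comp hf1 (degOne_ap _)) ?_ ?_
  · refine hdi.mono ?_
    rintro _ ⟨x, rfl⟩
    exact ⟨act g⁻¹ x, by simp [← act_mul, act_one]⟩
  · intro x
    simp only [Function.comp, hf2, hρ, hF3]
  · intro x
    simp only [Function.comp, heq, hf2]

lemma exists_embedding [Countable G] (c : G → G → G → ℤ) (hc : IsCircularOrder c) :
    ∃ e : G → S1, Function.Injective e ∧
      ∀ a b d, circOrd (e a) (e b) (e d) = c a b d := by
  classical
  obtain ⟨hz, hv, hco, -⟩ := hc
  have hz' : ∀ a b d, (a = b ∨ b = d ∨ a = d) → c a b d = 0 := fun a b d => (hz a b d).2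
  have hswap : ∀ a b, c 1 a b = - c 1 b a := by
    intro a b
    have := hco 1 a b a
    rw [hz' a b a (by simp), hz' 1 a a (by simp)] at this
    omega
  have hexp : ∀ a b d, c a b d = c 1 b d - c 1 a d + c 1 a b := by
    intro a b d
    have := hco 1 a b d
    omega
  let lt : G → G → Prop := fun a b => (a = 1 ∧ b ≠ 1) ∨ c 1 a b = 1
  have hirr : ∀ a, ¬ lt a a := by
    rintro a (h | h)
    · exact h.2 h.1
    · rw [hz' 1 a a (by simp)] at h; norm_num at h
  have htri : ∀ a b, lt a b ∨ a = b ∨ lt b a := by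
    intro a b
    by_cases hab : a = b
    · exact Or.inr (Or.inl hab)
    by_cases ha : a = 1
    · left; left; exact ⟨ha, fun hb => hab (ha.trans hb.symm)⟩
    by_cases hb : b = 1
    · right; right; left; exact ⟨hb, ha⟩
    have h0 : c 1 a b ≠ 0 := by
      intro h
      rcases (hz 1 a b).1 h with h | h | h
      · exact ha h.symm
      · exact hab h
      · exact hb h.symm
    have := hswap a b
    rcases hv 1 a b with h | h | h
    · left; right; exact h
    · exact absurd h h0
    · right; right; right; omega
  have hne1 : ∀ a b, c 1 a b = 1 → a ≠ 1 ∧ b ≠ 1 := by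
    intro a b h
    constructor
    · rintro rfl; rw [hz' 1 1 b (by simp)] at h; norm_num at h
    · rintro rfl; rw [hz' 1 a 1 (by simp)] at h; norm_num at h
  have htrans : ∀ a b d, lt a b → lt b d → lt a d := by
    rintro a b d (h | h) (h' | h')
    · exact absurd h'.1 h.2
    · left; exact ⟨h.1, (hne1 _ _ h').2⟩
    · exact absurd h'.1 (hne1 _ _ h).2
    · right
      have h1 := hexp a b d
      rcases hv a b d with h2 | h2 | h2 <;> rcases hv 1 a d with h3 | h3 | h3 <;> try omega
  have hcase : ∀ a b d, lt a b → lt b d → c a b d = 1 := by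
    intro a b d h1 h2
    have h3 := htrans a b d h1 h2
    have e := hexp a b d
    rcases h1 with h1 | h1
    · rcases h2 with h2 | h2
      · exact absurd h2.1 h1.2
      · rw [e, h1.1, hz' 1 1 d (by simp), hz' 1 1 b (by simp), h2]; norm_num
    · have hb := hne1 _ _ h1
      rcases h2 with h2 | h2
      · exact absurd h2.1 hb.2
      · rcases h3 with h3 | h3
        · exact absurd h3.1 hb.1
        · omega
  haveI : IsStrictTotalOrder G lt :=
    { trichotomous := fun a b h1 h2 => (htri a b).resolve_left h1 |>.resolve_right h2
      irrefl := hirr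
      trans := htrans }
  letI : LinearOrder G := linearOrderOfSTO lt
  haveI : Nontrivial (Set.Ico (0:ℝ) 1) :=
    ⟨⟨⟨0, by norm_num, by norm_num⟩, ⟨1/2, by norm_num, by norm_num⟩, by
      intro h; have := congrArg Subtype.val h; norm_num at this⟩⟩
  obtain ⟨φ⟩ := Order.embedding_from_countable_to_dense G (Set.Ico (0:ℝ) 1)
  have hφ : ∀ a b, ((φ a : ℝ) < φ b) ↔ lt a b := by
    intro a b
    rw [Subtype.coe_lt_coe, φ.lt_iff_lt]
    exact Iff.rfl
  have hrep : ∀ a, S1.rep ((φ a : ℝ) : S1) = φ a := fun a => rep_coe _ (φ a).2.1 (φ a).2.2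
  have hinj : Function.Injective (fun a => ((φ a : ℝ) : S1)) := by
    intro a b h
    apply φ.injective
    apply Subtype.ext
    rw [← hrep a, ← hrep b]; exact congrArg _ h
  refine ⟨fun a => ((φ a : ℝ) : S1), hinj, ?_⟩
  have hrot : ∀ a b d, c a b d = c b d a := by
    intro a b d
    have h1 := hexp a b d
    have h2 := hexp b d a
    have := hswap a b; have := hswap a d; have := hswap b d
    omega
  have hsw : ∀ a b d, c a b d = - c a d b := by
    intro a b d
    have h1 := hexp a b d
    have h2 := hexp a d b
    have := hswap a b; have := hswap a d; have := hswap b d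
    omega
  have hone : ∀ a b d, circOrd ((φ a : ℝ) : S1) ((φ b : ℝ) : S1) ((φ d : ℝ) : S1) = 1 →
      c a b d = 1 := by
    intro a b d h
    rw [circOrd_eq_one_iff, hrep, hrep, hrep] at h
    unfold cyc3 at h
    simp only [hφ] at h
    rcases h with h | h | h
    · exact hcase _ _ _ h.1 h.2
    · rw [hrot]; exact hcase _ _ _ h.1 h.2
    · rw [hrot, hrot]; exact hcase _ _ _ h.1 h.2
  intro a b d
  by_cases h : a = b ∨ b = d ∨ a = d
  · rw [hz' a b d h]
    rw [circOrd_eq_zero_iff]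
    rcases h with rfl | rfl | rfl <;> simp
  · push Not at h
    rcases circOrd_total (hinj.ne h.1) (hinj.ne h.2.1) (hinj.ne h.2.2) with h' | h'
    · rw [hone _ _ _ h', h']
    · have := hone _ _ _ h'
      have h2 := hsw a b d
      rw [← circOrd_eq_neg_one_iff] at h'
      rw [h']; omega

abbrev TT : Type := Set.Ico (0 : ℚ) 1

structure Good (s : G) (e : G → S1) (j : G × TT → S1) : Prop where
  zero : ∀ g (t : TT), (t : ℚ) = 0 → j (g, t) = e g
  mono : ∀ g (t t' : TT), t < t' → S1.rep (j (g, t) - e g) < S1.rep (j (g, t') - e g)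
  lt : ∀ g t, S1.rep (j (g, t) - e g) < S1.rep (e (g * s) - e g)
  le : ∀ g h, h ≠ g → S1.rep (e (g * s) - e g) ≤ S1.rep (e h - e g)

def t0 : TT := ⟨0, by norm_num, by norm_num⟩

section
variable {s : G} {e : G → S1} {j : G × TT → S1}

lemma Good.disj (H : Good s e j) {g h : G} (hgh : g ≠ h) (t t' : TT) :
    S1.rep (j (g, t) - e g) < S1.rep (j (h, t') - e g) := by
  by_contra hcon
  push Not at hcon
  have h1 : S1.rep (j (h, t') - e g) < S1.rep (e h - e g) :=
    lt_of_le_of_lt hcon ((H.lt g t).trans_le (H.le g h hgh.symm))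
  have h2 : S1.rep (j (h, t') - e h) < S1.rep (e g - e h) :=
    (H.lt h t').trans_le (H.le h g hgh)
  rw [rep_sub_lt_iff] at h1
  rcases h1 with h1 | h1
  · rw [h1.1] at h2; exact lt_irrefl _ h2
  · have h3 := (rep_sub_lt_iff (e h)).2 (Or.inr (circOrd_rot (circOrd_rot h1)))
    exact lt_asymm h2 h3

lemma Good.inj (H : Good s e j) : Function.Injective j := by
  rintro ⟨g, t⟩ ⟨h, t'⟩ hjj
  by_cases hgh : g = h
  · subst hgh
    rcases lt_trichotomy t t' with h | h | h
    · have := H.mono g t t' h; rw [hjj] at this; exact absurd this (lt_irrefl _)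
    · rw [h]
    · have := H.mono g t' t h; rw [hjj] at this; exact absurd this (lt_irrefl _)
  · have := H.disj hgh t t'; rw [hjj] at this; exact absurd this (lt_irrefl _)

lemma Good.one (H : Good s e j) (g : G) {t1 t2 t3 : TT} (h1 : t1 < t2) (h2 : t2 < t3) :
    circOrd (j (g, t1)) (j (g, t2)) (j (g, t3)) = 1 := by
  rw [circOrd_iff_base (e g)]
  exact Or.inl ⟨H.mono _ _ _ h1, H.mono _ _ _ h2⟩

lemma Good.two (H : Good s e j) {g k : G} (hgk : g ≠ k) {t1 t2 : TT} (h1 : t1 < t2) (t3 : TT) :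
    circOrd (j (g, t1)) (j (g, t2)) (j (k, t3)) = 1 := by
  rw [circOrd_iff_base (e g)]
  exact Or.inl ⟨H.mono _ _ _ h1, H.disj hgk _ _⟩

lemma Good.move (H : Good s e j) {g h k : G} (h1 : g ≠ h) (h3 : g ≠ k)
    (t1 t1' t2 t3 : TT) : circOrd (j (g, t1)) (j (h, t2)) (j (k, t3)) =
      circOrd (j (g, t1')) (j (h, t2)) (j (k, t3)) := by
  have a1 := H.disj h1 t1 t2
  have a2 := H.disj h3 t1 t3
  have b1 := H.disj h1 t1' t2
  have b2 := H.disj h3 t1' t3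
  apply circOrd_congr <;> rw [circOrd_iff_base (e g), circOrd_iff_base (e g)] <;>
  · unfold cyc3
    constructor <;> rintro (h | h | h) <;>
    first
    | (left; constructor <;> linarith [h.1, h.2])
    | (right; left; constructor <;> linarith [h.1, h.2])
    | (right; right; constructor <;> linarith [h.1, h.2])

lemma Good.three (H : Good s e j) {g h k : G} (h1 : g ≠ h) (h2 : h ≠ k) (h3 : g ≠ k)
    (t1 t2 t3 : TT) : circOrd (j (g, t1)) (j (h, t2)) (j (k, t3)) =
      circOrd (e g) (e h) (e k) := by
  rw [H.move h1 h3 t1 t0, ← circOrd_rot_eq, H.move h2 h1.symm t2 t0, ← circOrd_rot_eq,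
    H.move h3.symm h2.symm t3 t0, ← circOrd_rot_eq, H.zero _ t0 rfl, H.zero _ t0 rfl,
    H.zero _ t0 rfl]

lemma Good.same_aux {e' : G → S1} {j' : G × TT → S1} (H : Good s e j) (H' : Good s e' j')
    (hee : ∀ a b d, circOrd (e a) (e b) (e d) = circOrd (e' a) (e' b) (e' d)) (x y z : G × TT)
    (h : circOrd (j x) (j y) (j z) = 1) : circOrd (j' x) (j' y) (j' z) = 1 := by
  have two : ∀ (g k : G) (_ : g ≠ k) (t1 t2 t3 : TT),
      circOrd (j (g, t1)) (j (g, t2)) (j (k, t3)) = 1 →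
      circOrd (j' (g, t1)) (j' (g, t2)) (j' (k, t3)) = 1 := by
    intro g k hgk t1 t2 t3 h
    rcases lt_trichotomy t1 t2 with h' | h' | h'
    · exact H'.two hgk h' t3
    · rw [h'] at h; exact absurd rfl (circOrd_ne h).1
    · exact (circOrd_asymm (circOrd_rot h) (H.two hgk h' t3)).elim
  obtain ⟨g, t1⟩ := x
  obtain ⟨h', t2⟩ := y
  obtain ⟨k, t3⟩ := z
  by_cases e1 : g = h'
  · subst e1
    by_cases e2 : g = k
    · subst e2
      have hne := circOrd_ne h
      have n1 : t1 ≠ t2 := by rintro rfl; exact hne.1 rfl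
      have n2 : t2 ≠ t3 := by rintro rfl; exact hne.2.1 rfl
      have n3 : t1 ≠ t3 := by rintro rfl; exact hne.2.2 rfl
      rcases lt_or_gt_of_ne n1 with l1 | l1 <;> rcases lt_or_gt_of_ne n2 with l2 | l2
      · exact H'.one g l1 l2
      · rcases lt_or_gt_of_ne n3 with l3 | l3
        · exact (circOrd_asymm h (H.one g l3 l2)).elim
        · exact circOrd_rot (H'.one g l3 l1)
      · rcases lt_or_gt_of_ne n3 with l3 | l3
        · exact (circOrd_asymm h (circOrd_rot (H.one g l1 l3))).elim
        · exact circOrd_rot (circOrd_rot (H'.one g l2 l3))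
      · exact (circOrd_asymm h (circOrd_rot (circOrd_rot (H.one g l2 l1)))).elim
    · exact two g k e2 t1 t2 t3 h
  · by_cases e2 : h' = k
    · subst e2
      exact circOrd_rot (circOrd_rot (two _ _ (Ne.symm e1) _ _ _ (circOrd_rot h)))
    · by_cases e3 : g = k
      · subst e3
        exact circOrd_rot (two _ _ e1 _ _ _ (circOrd_rot (circOrd_rot h)))
      · rw [H.three e1 e2 e3] at h
        rw [H'.three e1 e2 e3, ← hee, h]

lemma Good.same {e' : G → S1} {j' : G × TT → S1} (H : Good s e j) (H' : Good s e' j')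
    (hee : ∀ a b d, circOrd (e a) (e b) (e d) = circOrd (e' a) (e' b) (e' d)) (x y z : G × TT) :
    circOrd (j x) (j y) (j z) = circOrd (j' x) (j' y) (j' z) :=
  circOrd_congr ⟨H.same_aux H' hee _ _ _, H'.same_aux H (fun a b d => (hee a b d).symm) _ _ _⟩
    ⟨H.same_aux H' hee _ _ _, H'.same_aux H (fun a b d => (hee a b d).symm) _ _ _⟩

lemma Good.dense (H : Good s e j) (x y : G × TT) (hxy : x ≠ y) :
    ∃ z, circOrd (j x) (j z) (j y) = 1 := by
  obtain ⟨g, t⟩ := x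
  obtain ⟨h, t'⟩ := y
  obtain ⟨t2, ht2⟩ : ∃ t2, t < t2 :=
    ⟨⟨((t : ℚ) + 1) / 2, by have := t.2.1; linarith, by have := t.2.2; linarith⟩, by
      rw [← Subtype.coe_lt_coe]; have := t.2.2; simp only; linarith⟩
  by_cases hgh : g = h
  · subst hgh
    rcases lt_trichotomy t t' with h | h | h
    · obtain ⟨r, h1, h2⟩ := exists_between h
      exact ⟨(g, r), H.one g h1 h2⟩
    · exact absurd (by rw [h]) hxy
    · exact ⟨(g, t2), circOrd_rot (H.one g h ht2)⟩
  · exact ⟨(g, t2), H.two hgh ht2 t'⟩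

end

lemma tt_bd (t : TT) {L : ℝ} (h0 : 0 < L) :
    0 ≤ ((t : ℚ) : ℝ) * L ∧ ((t : ℚ) : ℝ) * L < L := by
  have h1 : (0:ℝ) ≤ ((t : ℚ) : ℝ) := by exact_mod_cast t.2.1
  have h2 : ((t : ℚ) : ℝ) < 1 := by exact_mod_cast t.2.2
  constructor
  · positivity
  · nlinarith

lemma tt_mono {t t' : TT} (h : t < t') {L : ℝ} (h0 : 0 < L) :
    ((t : ℚ) : ℝ) * L < ((t' : ℚ) : ℝ) * L := by
  have : ((t : ℚ) : ℝ) < ((t' : ℚ) : ℝ) := by exact_mod_cast h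
  nlinarith

lemma le_of_succ {s : G} {e : G → S1} (he : Function.Injective e)
    (hs : ∀ g h, circOrd (e g) (e h) (e (g * s)) ≠ 1) (g h : G) (hh : h ≠ g) :
    S1.rep (e (g * s) - e g) ≤ S1.rep (e h - e g) := by
  by_contra hcon
  push Not at hcon
  rw [rep_sub_lt_iff] at hcon
  rcases hcon with h' | h'
  · exact hh (he h'.1)
  · exact hs g h h'

lemma pos_of_succ {s : G} (hs1 : s ≠ 1) {e : G → S1} (he : Function.Injective e) (g : G) :
    0 < S1.rep (e (g * s) - e g) := by
  refine lt_of_le_of_ne (rep_nonneg _) (fun h => ?_)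
  have := rep_eq_zero.1 h.symm
  have := he (sub_eq_zero.1 this)
  exact hs1 (by simpa using this)

lemma good_affine {s : G} (hs1 : s ≠ 1) {e : G → S1} (he : Function.Injective e)
    (hs : ∀ g h, circOrd (e g) (e h) (e (g * s)) ≠ 1) :
    Good s e (fun x => ((((x.2 : ℚ) : ℝ) * S1.rep (e (x.1 * s) - e x.1) : ℝ) : S1) + e x.1) := by
  have key : ∀ g (t : TT), S1.rep (((((t : ℚ) : ℝ) * S1.rep (e (g * s) - e g) : ℝ) : S1) + e g - e g)
      = ((t : ℚ) : ℝ) * S1.rep (e (g * s) - e g) := by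
    intro g t
    have hL := pos_of_succ hs1 he g
    rw [add_sub_cancel_right]
    exact rep_coe _ (tt_bd t hL).1 ((tt_bd t hL).2.trans (rep_lt_one _))
  refine ⟨?_, ?_, ?_, le_of_succ he hs⟩
  · intro g t ht
    simp [ht]
  · intro g t t' htt
    simp only [key]
    exact tt_mono htt (pos_of_succ hs1 he g)
  · intro g t
    simp only [key]
    exact (tt_bd t (pos_of_succ hs1 he g)).2

lemma rep_lt_ap (h : ↥HomeoPos) {a y z : S1} (hlt : S1.rep (y - a) < S1.rep (z - a)) :
    S1.rep (ap h y - ap h a) < S1.rep (ap h z - ap h a) := by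
  rw [rep_sub_lt_iff] at *
  rcases hlt with h1 | h1
  · left; exact ⟨by rw [h1.1], fun e => h1.2 (h.1.injective e)⟩
  · right
    exact (h.2.2.2 a y z).trans h1

lemma good_action {s : G} (hs1 : s ≠ 1) (ρ : G →* ↥HomeoPos) (x₀ : S1)
    (he : Function.Injective (fun g => ap (ρ g) x₀))
    (hs : ∀ g h, circOrd (ap (ρ g) x₀) (ap (ρ h) x₀) (ap (ρ (g * s)) x₀) ≠ 1) :
    Good s (fun g => ap (ρ g) x₀)
      (fun x => ap (ρ x.1) (((((x.2 : ℚ) : ℝ) * S1.rep (ap (ρ s) x₀ - x₀) : ℝ) : S1) + x₀)) := by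
  have hL : 0 < S1.rep (ap (ρ s) x₀ - x₀) := by
    have := pos_of_succ hs1 he 1
    simpa [ap_one] using this
  have key : ∀ (t : TT), S1.rep (((((t : ℚ) : ℝ) * S1.rep (ap (ρ s) x₀ - x₀) : ℝ) : S1) + x₀ - x₀)
      = ((t : ℚ) : ℝ) * S1.rep (ap (ρ s) x₀ - x₀) := by
    intro t
    rw [add_sub_cancel_right]
    exact rep_coe _ (tt_bd t hL).1 ((tt_bd t hL).2.trans (rep_lt_one _))
  refine ⟨?_, ?_, ?_, le_of_succ he hs⟩
  · intro g t ht
    simp [ht]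
  · intro g t t' htt
    apply rep_lt_ap
    rw [key, key]
    exact tt_mono htt hL
  · intro g t
    simp only [map_mul, ap_mul]
    apply rep_lt_ap
    rw [key]
    exact (tt_bd t hL).2

lemma orbit_inj (ρ : G →* ↥HomeoPos) (x₀ : S1) (h : TrivialStabilizer ρ x₀) :
    Function.Injective (fun g => ap (ρ g) x₀) := by
  intro a b hab
  have hab : ap (ρ a) x₀ = ap (ρ b) x₀ := hab
  have h1 : ap (ρ (b⁻¹ * a)) x₀ = x₀ := by
    rw [map_mul, ap_mul, hab, ← ap_mul, ← map_mul, inv_mul_cancel, map_one, ap_one]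
  have := h _ h1
  exact (inv_mul_eq_one.1 this).symm


/-- **Existence of dynamical realizations.**  Every circular order `c` on a countable group
`G` admits a dynamical realization with any prescribed basepoint `x₀ ∈ S¹`. -/
theorem exists_dynamical_realization [Countable G]
    (c : G → G → G → ℤ) (hc : IsCircularOrder c) (x₀ : S1) :
    ∃ ρ : G →* ↥HomeoPos, IsDynamicalRealization ρ x₀ c := by
  classical
  obtain ⟨e, he, hec⟩ := exists_embedding c hc
  by_cases hsub : Subsingleton G
  · refine ⟨1, fun g _ => Subsingleton.elim _ _, ?_, ?_⟩
    · intro a b d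
      rw [Subsingleton.elim a b, (hc.1 b b d).2 (by simp)]
      exact circOrd_eq_zero_iff.2 (Or.inl rfl)
    · intro ρ' _ _
      refine ⟨id, ⟨continuous_id, Function.surjective_id, fun _ _ _ _ _ _ => rfl⟩, rfl, ?_⟩
      intro g
      rw [Subsingleton.elim g 1, map_one, map_one]
      rfl
  have hnt : ∃ g : G, g ≠ 1 := by
    by_contra hcon
    push Not at hcon
    exact hsub ⟨fun a b => (hcon a).trans (hcon b).symm⟩
  by_cases hd : ∀ a b : G, a ≠ b → ∃ h, c a h b = 1
  · obtain ⟨i, hi, hi0, hij, ρ, hρ, huniv⟩ := realize (G := G) (X := G) (fun g x => g * x)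
      one_mul mul_assoc 1 e he hnt
      (fun x y hxy => by obtain ⟨z, hz⟩ := hd x y hxy; exact ⟨z, by rw [hec, hz]⟩)
      (fun g x y z => by rw [hec, hec, hc.2.2.2]) x₀
    have horb : ∀ g, ap (ρ g) x₀ = i g := by
      intro g; rw [← hi0, hρ, mul_one]
    refine ⟨ρ, ?_, ?_, ?_⟩
    · intro g hg
      rw [horb, ← hi0] at hg
      exact hi hg
    · intro a b d
      unfold inducedCO
      rw [horb, horb, horb, hij, hec]
    · intro ρ' hst hind
      obtain ⟨f, hf1, hf2, hf3⟩ := huniv ρ' (fun g => ap (ρ' g) x₀) (orbit_inj ρ' x₀ hst)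
        (fun x y z => by rw [hec]; exact hind x y z)
        (fun g x => by rw [map_mul, ap_mul])
      refine ⟨f, hf1, ?_, hf3⟩
      have := hf2 1
      rw [map_one, ap_one, hi0] at this
      exact this
  · push Not at hd
    obtain ⟨a, b, hab, hs⟩ := hd
    set s := a⁻¹ * b with hsdef
    have hs1 : s ≠ 1 := fun h => hab (inv_mul_eq_one.1 h)
    have hsucc : ∀ g h, c g h (g * s) ≠ 1 := by
      intro g h
      have h1 := hc.2.2.2 (a * g⁻¹) g h (g * s)
      rw [← h1]
      have e1 : a * g⁻¹ * g = a := by group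
      have e2 : a * g⁻¹ * (g * s) = b := by rw [hsdef]; group
      rw [e1, e2]
      exact hs _
    have H := good_affine hs1 he (fun g h => by rw [hec]; exact hsucc g h)
    set j : G × TT → S1 :=
      (fun x => ((((x.2 : ℚ) : ℝ) * S1.rep (e (x.1 * s) - e x.1) : ℝ) : S1) + e x.1) with hj
    have Hg : ∀ g, Good s (fun h => e (g * h)) (fun x => j (g * x.1, x.2)) := by
      intro g
      refine ⟨fun h t ht => H.zero _ _ ht, fun h t t' htt => H.mono _ _ _ htt, fun h t => ?_, fun h k hk => ?_⟩
      · rw [← mul_assoc]; exact H.lt _ _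
      · rw [← mul_assoc]; exact H.le _ _ (fun h => hk (mul_left_cancel h))
    obtain ⟨i, hi, hi0, hij, ρ, hρ, huniv⟩ := realize (G := G) (X := G × TT)
      (fun g x => (g * x.1, x.2))
      (fun x => by simp) (fun g h x => by simp [mul_assoc]) (1, t0) j H.inj
      (by obtain ⟨g, hg⟩ := hnt; exact ⟨(g, t0), fun h => hg (congrArg Prod.fst h)⟩)
      H.dense
      (fun g x y z => ((Hg g).same H (fun a b d => by rw [hec, hec, hc.2.2.2]) x y z)) x₀
    have horb : ∀ g, ap (ρ g) x₀ = i (g, t0) := by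
      intro g; rw [← hi0, hρ, mul_one]
    refine ⟨ρ, ?_, ?_, ?_⟩
    · intro g hg
      rw [horb, ← hi0] at hg
      exact congrArg Prod.fst (hi hg)
    · intro a b d
      unfold inducedCO
      rw [horb, horb, horb, hij, H.zero _ t0 rfl, H.zero _ t0 rfl, H.zero _ t0 rfl, hec]
    · intro ρ' hst hind
      have hind' : ∀ x y z, circOrd (ap (ρ' x) x₀) (ap (ρ' y) x₀) (ap (ρ' z) x₀) = c x y z := hind
      have H' := good_action hs1 ρ' x₀ (orbit_inj ρ' x₀ hst)
        (fun g h => by rw [hind']; exact hsucc g h)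
      obtain ⟨f, hf1, hf2, hf3⟩ := huniv ρ' _ H'.inj
        (H'.same H (fun a b d => by rw [hec, hind']))
        (fun g x => by simp only [map_mul, ap_mul])
      refine ⟨f, hf1, ?_, hf3⟩
      have := hf2 (1, t0)
      rw [hi0, H'.zero _ t0 rfl] at this
      simpa [ap_one] using this

end
end

section
/- Let G be a countable infinite group and ι : G → ℝ/ℤ an injective group homomorphism into the circle group. Then the circular order c on G defined by c(g₁,g₂,g₃) := ord(ι(g₁), ι(g₂), ι(g₃)) is not isolated in CO(G). -/
namespace RotAux

open Filter Topology

lemma rep_nonneg (x : S1) : 0 ≤ S1.rep x := (AddCircle.equivIco (1 : ℝ) 0 x).2.1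

lemma rep_lt_one (x : S1) : S1.rep x < 1 := by
  have := (AddCircle.equivIco (1 : ℝ) 0 x).2.2
  simpa [S1.rep] using this

lemma coe_rep (x : S1) : ((S1.rep x : ℝ) : S1) = x := AddCircle.coe_equivIco

lemma rep_coe (r : ℝ) : S1.rep (r : S1) = Int.fract r := by
  have := AddCircle.coe_equivIco_mk_apply (1 : ℝ) r
  simpa [S1.rep] using this

lemma rep_inj {x y : S1} : S1.rep x = S1.rep y ↔ x = y :=
  ⟨fun h => by rw [← coe_rep x, h, coe_rep], fun h => by rw [h]⟩

lemma rep_zero : S1.rep 0 = 0 := by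
  have := rep_coe 0
  simpa using this

lemma rep_pos {x : S1} (h : x ≠ 0) : 0 < S1.rep x :=
  lt_of_le_of_ne (rep_nonneg x) (fun h' => h (rep_inj.1 (by rw [rep_zero, ← h'])))

lemma rep_add (x g : S1) :
    S1.rep (x + g) = S1.rep x + S1.rep g - (if S1.rep x + S1.rep g < 1 then 0 else 1) := by
  have h : S1.rep (x + g) = Int.fract (S1.rep x + S1.rep g) := by
    rw [← rep_coe]; rw [AddCircle.coe_add, coe_rep, coe_rep]
  have h1 := rep_nonneg x
  have h2 := rep_nonneg g
  have h3 := rep_lt_one x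
  have h4 := rep_lt_one g
  rw [h]
  split_ifs with hc
  · rw [Int.fract_eq_iff]; exact ⟨by linarith, by linarith, 0, by simp⟩
  · rw [Int.fract_eq_iff]; exact ⟨by linarith, by linarith, 1, by simp⟩

/-- sign of `rep y - rep x` -/
noncomputable def sg (x y : S1) : ℤ :=
  if S1.rep x < S1.rep y then 1 else if S1.rep y < S1.rep x then -1 else 0

lemma circOrd_eq (x y z : S1) : circOrd x y z = sg x y + sg y z - sg x z := by
  unfold circOrd sg
  simp only [← rep_inj]
  generalize S1.rep x = a
  generalize S1.rep y = b
  generalize S1.rep z = c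
  rcases lt_trichotomy a b with h1 | h1 | h1 <;> rcases lt_trichotomy b c with h2 | h2 | h2 <;>
    rcases lt_trichotomy a c with h3 | h3 | h3 <;> grind

lemma circOrd_cocycle (x y z w : S1) :
    circOrd y z w - circOrd x z w + circOrd x y w - circOrd x y z = 0 := by
  simp only [circOrd_eq]; ring

lemma circOrd_zero_iff (x y z : S1) : circOrd x y z = 0 ↔ x = y ∨ y = z ∨ x = z := by
  unfold circOrd; split_ifs <;> simp_all

lemma circOrd_vals (x y z : S1) :
    circOrd x y z = 1 ∨ circOrd x y z = 0 ∨ circOrd x y z = -1 := by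
  unfold circOrd; split_ifs <;> simp

lemma sg_add (x y g : S1) : sg (x + g) (y + g) = sg x y
    + 2 * ((if S1.rep x + S1.rep g < 1 then 0 else 1) - (if S1.rep y + S1.rep g < 1 then 0 else 1)) := by
  unfold sg
  rw [rep_add, rep_add]
  have := rep_nonneg x
  have := rep_nonneg y
  have := rep_lt_one x
  have := rep_lt_one y
  generalize S1.rep x = a at *
  generalize S1.rep y = b at *
  generalize S1.rep g = c at *
  split_ifs <;> first | rfl | (exfalso; linarith)

lemma circOrd_add (g x y z : S1) : circOrd (g + x) (g + y) (g + z) = circOrd x y z := by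
  simp only [add_comm g, circOrd_eq, sg_add]; ring

lemma circOrd_zero {y z : S1} (hy : y ≠ 0) (hz : z ≠ 0) : circOrd 0 y z = sg y z := by
  have h : ∀ w : S1, w ≠ 0 → sg 0 w = 1 := fun w hw => by
    unfold sg; rw [rep_zero, if_pos (rep_pos hw)]
  rw [circOrd_eq, h y hy, h z hz]; ring

lemma circOrd_base (x y z : S1) : circOrd x y z = circOrd 0 (y - x) (z - x) := by
  rw [← circOrd_add x 0]; simp

/-- The orders on multiples of a nonzero point determine the point. -/
lemma eq_of_circ {x y : S1} (hx : x ≠ 0) (hy : y ≠ 0)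
    (h : ∀ k : ℕ, circOrd 0 (k • x) ((k + 1) • x) = circOrd 0 (k • y) ((k + 1) • y)) :
    x = y := by
  have key : ∀ k : ℕ, (k • x = 0 ↔ k • y = 0) ∧
      k * S1.rep x - S1.rep (k • x) = k * S1.rep y - S1.rep (k • y) := by
    intro k
    induction k with
    | zero => simp
    | succ k ih =>
      obtain ⟨ih1, ih2⟩ := ih
      have hk := h k
      have hz : ((k + 1) • x = 0 ↔ (k + 1) • y = 0) := by
        have e1 := circOrd_zero_iff 0 (k • x) ((k + 1) • x)
        have e2 := circOrd_zero_iff 0 (k • y) ((k + 1) • y)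
        rw [hk, e2] at e1
        have nx : k • x ≠ (k + 1) • x := by rw [succ_nsmul]; simpa using hx
        have ny : k • y ≠ (k + 1) • y := by rw [succ_nsmul]; simpa using hy
        by_cases hkx : k • x = 0
        · have hky := ih1.1 hkx
          rw [succ_nsmul, succ_nsmul, hkx, hky]; simp [hx, hy]
        · have hky : ¬ k • y = 0 := fun h' => hkx (ih1.2 h')
          simp only [eq_comm (a := (0 : S1)), hkx, hky, nx, ny, false_or] at e1
          exact e1.symm
      refine ⟨hz, ?_⟩
      have px := rep_pos hx
      have py := rep_pos hy
      have lx := rep_lt_one x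
      have ly := rep_lt_one y
      have ax := rep_add (k • x) x
      have ay := rep_add (k • y) y
      rw [← succ_nsmul] at ax ay
      suffices hw : (S1.rep (k • x) + S1.rep x < 1 ↔ S1.rep (k • y) + S1.rep y < 1) by
        rw [ax, ay]
        push_cast
        simp only [hw]
        linarith
      by_cases hkx : k • x = 0
      · have hky := ih1.1 hkx
        rw [hkx, hky, rep_zero]; simp [lx, ly]
      have hky : ¬ k • y = 0 := fun h' => hkx (ih1.2 h')
      by_cases hsx : (k + 1) • x = 0
      · have hsy := hz.1 hsx
        rw [hsx, rep_zero] at ax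
        rw [hsy, rep_zero] at ay
        have := rep_nonneg (k • x)
        have := rep_nonneg (k • y)
        split_ifs at ax ay <;> first | (exfalso; linarith) | simp_all
      have hsy : ¬ (k + 1) • y = 0 := fun h' => hsx (hz.2 h')
      rw [circOrd_zero hkx hsx, circOrd_zero hky hsy] at hk
      unfold sg at hk
      rw [ax, ay] at hk
      split_ifs at hk <;> first | (exfalso; linarith) | (constructor <;> intro <;> linarith) | simp_all
  have hb : ∀ k : ℕ, k * |S1.rep x - S1.rep y| < 1 := by
    intro k
    have h1 := (key k).2
    have e : (k : ℝ) * |S1.rep x - S1.rep y| = |S1.rep (k • x) - S1.rep (k • y)| := by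
      have e1 : S1.rep (k • x) - S1.rep (k • y) = k * (S1.rep x - S1.rep y) := by linarith
      rw [e1, abs_mul, Nat.abs_cast]
    rw [e, abs_lt]
    constructor <;> linarith [rep_nonneg (k • x), rep_nonneg (k • y), rep_lt_one (k • x),
      rep_lt_one (k • y)]
  by_contra hne
  have hp : 0 < |S1.rep x - S1.rep y| := abs_pos.2 (sub_ne_zero.2 (fun h' => hne (rep_inj.1 h')))
  obtain ⟨n, hn⟩ := exists_nat_gt (1 / |S1.rep x - S1.rep y|)
  rw [div_lt_iff₀ hp] at hn
  linarith [hb n]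

lemma circ_of_hom {G : Type*} [Group G] (f : G → S1) (hf : ∀ a b, f (a * b) = f a + f b)
    (hi : Function.Injective f) : IsCircularOrder (fun a b c => circOrd (f a) (f b) (f c)) := by
  refine ⟨fun a b d => ?_, fun a b d => circOrd_vals _ _ _, fun a b c d => circOrd_cocycle _ _ _ _,
    fun g u v w => ?_⟩
  · simp only [circOrd_zero_iff, hi.eq_iff]
  · simp only [hf, circOrd_add]

lemma inj_of_ker {G : Type*} [Group G] (f : G → S1) (hf : ∀ a b, f (a * b) = f a + f b)
    (hk : ∀ a, f a = 0 → a = 1) : Function.Injective f := by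
  intro a b hab
  have : f (a * b⁻¹) = 0 := by
    have h1 := hf (a * b⁻¹) b
    rw [inv_mul_cancel_right, hab] at h1
    simpa using h1
  exact mul_inv_eq_one.1 (hk _ this)

lemma f_one {G : Type*} [Group G] (f : G → S1) (hf : ∀ a b, f (a * b) = f a + f b) : f 1 = 0 := by
  simpa using hf 1 1

lemma f_pow {G : Type*} [Group G] (f : G → S1) (hf : ∀ a b, f (a * b) = f a + f b) (g : G) (k : ℕ) :
    f (g ^ k) = k • f g := by
  induction k with
  | zero => simp [f_one f hf]
  | succ k ih => rw [pow_succ, hf, ih, succ_nsmul]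

lemma ultra {G : Type*} [Group G] (U : Ultrafilter ℕ) (F : ℕ → G → S1)
    (hf : ∀ i a b, F i (a * b) = F i a + F i b)
    (hk : ∀ a b, a ≠ b → ∀ᶠ i in (U : Filter ℕ), F i a ≠ F i b) :
    ∃ c' : G → G → G → ℤ, IsCircularOrder c' ∧
      ∀ a b d, ∀ᶠ i in (U : Filter ℕ), circOrd (F i a) (F i b) (F i d) = c' a b d := by
  have ex : ∀ a b d, ∃ v : ℤ, ∀ᶠ i in (U : Filter ℕ), circOrd (F i a) (F i b) (F i d) = v := by
    intro a b d
    have : ∀ᶠ i in (U : Filter ℕ), (circOrd (F i a) (F i b) (F i d) = 1 ∨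
      circOrd (F i a) (F i b) (F i d) = 0 ∨ circOrd (F i a) (F i b) (F i d) = -1) :=
      Eventually.of_forall fun i => circOrd_vals _ _ _
    rw [Ultrafilter.eventually_or, Ultrafilter.eventually_or] at this
    rcases this with h | h | h
    exacts [⟨_, h⟩, ⟨_, h⟩, ⟨_, h⟩]
  choose c' hc using ex
  refine ⟨c', ⟨fun a b d => ⟨fun h0 => ?_, fun h0 => ?_⟩, fun a b d => ?_, fun x y z w => ?_,
    fun g u v w => ?_⟩, hc⟩
  · by_contra hne
    push Not at hne
    obtain ⟨i, h1, h2, h3, h4⟩ := ((hc a b d).and ((hk _ _ hne.1).and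
      ((hk _ _ hne.2.1).and (hk _ _ hne.2.2)))).exists
    rw [h0, circOrd_zero_iff] at h1
    tauto
  · obtain ⟨i, h1⟩ := (hc a b d).exists
    rw [← h1, circOrd_zero_iff]
    rcases h0 with h | h | h <;> simp [h]
  · obtain ⟨i, h1⟩ := (hc a b d).exists
    rw [← h1]; exact circOrd_vals _ _ _
  · obtain ⟨i, h1, h2, h3, h4⟩ := ((hc y z w).and ((hc x z w).and
      ((hc x y w).and (hc x y z)))).exists
    rw [← h1, ← h2, ← h3, ← h4]; exact circOrd_cocycle _ _ _ _
  · obtain ⟨i, h1, h2⟩ := ((hc (g * u) (g * v) (g * w)).and (hc u v w)).exists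
    rw [← h1, ← h2, hf, hf, hf, circOrd_add]

lemma exists_unit (n d : ℕ) (hn : 0 < n) (hd : 0 < d) (h : ¬ d ∣ 2 * n) :
    ∃ m : ℕ, 0 < m ∧ n ∣ m ∧ d ∣ m ∧ ∃ u : (ZMod m)ˣ, ∀ p : ℕ, (p : ZMod m) = u →
      (p : ZMod n) = 1 ∧ (p : ZMod d) ≠ 1 := by
  have hm : 0 < Nat.lcm n d := Nat.lcm_pos hn hd
  obtain ⟨k, hk⟩ := Nat.dvd_lcm_left n d
  have hdm := Nat.dvd_lcm_right n d
  have hnm := Nat.dvd_lcm_left n d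
  have hmin : ∀ j, n ∣ j → d ∣ j → Nat.lcm n d ∣ j := fun j => Nat.lcm_dvd
  refine ⟨Nat.lcm n d, hm, hnm, hdm, ?_⟩
  generalize Nat.lcm n d = m at *
  have : NeZero m := ⟨hm.ne'⟩
  have : NeZero n := ⟨hn.ne'⟩
  have hk3 : 3 ≤ k := by
    by_contra hlt
    have : k = 0 ∨ k = 1 ∨ k = 2 := by omega
    rcases this with rfl | rfl | rfl
    · omega
    · exact h (hdm.trans ⟨2, by rw [hk]; ring⟩)
    · exact h (hdm.trans ⟨1, by rw [hk]; ring⟩)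
  have hcard : n.totient < m.totient := by
    have h1 := Nat.totient_super_multiplicative n k
    have h2 : k.totient ≠ 1 := by rw [Ne, Nat.totient_eq_one_iff]; omega
    have h3 : 0 < k.totient := Nat.totient_pos.2 (by omega)
    have h4 : 0 < n.totient := Nat.totient_pos.2 hn
    rw [← hk] at h1
    have : n.totient * 2 ≤ n.totient * k.totient := Nat.mul_le_mul_left _ (by omega)
    omega
  rw [← ZMod.card_units_eq_totient, ← ZMod.card_units_eq_totient] at hcard
  obtain ⟨v, w, hvw, he⟩ := Fintype.exists_ne_map_eq_of_card_lt (ZMod.unitsMap hnm) hcard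
  have hu : ZMod.unitsMap hnm (v * w⁻¹) = 1 := by rw [map_mul, map_inv, he, mul_inv_cancel]
  have hu1 : v * w⁻¹ ≠ 1 := fun h' => hvw (mul_inv_eq_one.1 h')
  refine ⟨v * w⁻¹, fun p hp => ?_⟩
  generalize v * w⁻¹ = u at *
  have hpn : (p : ZMod n) = 1 := by
    have h1 : ((ZMod.unitsMap hnm u : (ZMod n)ˣ) : ZMod n) = 1 := by rw [hu]; rfl
    rw [ZMod.unitsMap_def, Units.coe_map, ← hp] at h1
    simpa using h1
  refine ⟨hpn, fun hpd => hu1 (Units.ext ?_)⟩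
  rw [← hp, Units.val_one]
  have a1 : (n : ℤ) ∣ p - 1 := by
    rw [← ZMod.intCast_zmod_eq_zero_iff_dvd]; push_cast; rw [hpn, sub_self]
  have a2 : (d : ℤ) ∣ p - 1 := by
    rw [← ZMod.intCast_zmod_eq_zero_iff_dvd]; push_cast; rw [hpd, sub_self]
  have a3 : (m : ℤ) ∣ p - 1 := by
    rw [Int.natCast_dvd] at *; exact hmin _ a1 a2
  rw [← ZMod.intCast_zmod_eq_zero_iff_dvd] at a3
  push_cast at a3
  exact sub_eq_zero.1 a3

lemma torsion_case {G : Type*} [Group G] [Infinite G] (f : G → S1)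
    (hf : ∀ a b, f (a * b) = f a + f b) (hi : Function.Injective f)
    (ht : ∀ g, IsOfFinAddOrder (f g)) (S : Finset G) :
    ∃ c' : G → G → G → ℤ, IsCircularOrder c' ∧
      (∀ u ∈ S, ∀ v ∈ S, ∀ w ∈ S, c' u v w = circOrd (f u) (f v) (f w)) ∧
      c' ≠ fun a b c => circOrd (f a) (f b) (f c) := by
  obtain ⟨n, hn, hnS⟩ : ∃ n : ℕ, 0 < n ∧ ∀ s ∈ S, addOrderOf (f s) ∣ n :=
    ⟨∏ s ∈ S, addOrderOf (f s), Finset.prod_pos fun s _ => (ht s).addOrderOf_pos,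
      fun s hs => Finset.dvd_prod_of_mem _ hs⟩
  obtain ⟨g, hg⟩ : ∃ g, ¬ (2 * n) • f g = 0 := by
    by_contra hcon
    push Not at hcon
    have hfin := AddCircle.finite_torsion (1 : ℝ) (n := 2 * n) (by omega)
    exact Set.infinite_range_of_injective hi (hfin.subset (by rintro _ ⟨g, rfl⟩; exact hcon g))
  have hdpos := (ht g).addOrderOf_pos
  obtain ⟨m, hm, hnm, hdm, u, hu⟩ := exists_unit n (addOrderOf (f g)) hn hdpos
    (fun h => hg (addOrderOf_dvd_iff_nsmul_eq_zero.1 h))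
  have : NeZero m := ⟨hm.ne'⟩
  let P : Set ℕ := {p | p.Prime ∧ (p : ZMod m) = u}
  have hP : ∃ᶠ p in atTop, p ∈ P := by
    rw [frequently_atTop]
    intro N
    obtain ⟨p, h1, h2, h3⟩ := Nat.forall_exists_prime_gt_and_eq_mod u.isUnit N
    exact ⟨p, h1.le, h2, h3⟩
  have : NeBot (atTop ⊓ 𝓟 P) := frequently_mem_iff_neBot.1 hP
  let U := Ultrafilter.of (atTop ⊓ 𝓟 P)
  have hU : (U : Filter ℕ) ≤ atTop ⊓ 𝓟 P := Ultrafilter.of_le _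
  have hUP : ∀ᶠ p in (U : Filter ℕ), p ∈ P := hU (mem_inf_of_right (mem_principal_self P))
  have hUN : ∀ N, ∀ᶠ p in (U : Filter ℕ), N < p := fun N =>
    hU (mem_inf_of_left (eventually_gt_atTop N))
  have hne : ∀ a : G, a ≠ 1 → ∀ᶠ p in (U : Filter ℕ), p • f a ≠ 0 := by
    intro a ha
    filter_upwards [hUP, hUN (addOrderOf (f a))] with p hp hlt h0
    rcases (Nat.dvd_prime hp.1).1 (addOrderOf_dvd_iff_nsmul_eq_zero.2 h0) with h1 | h1
    · rw [AddMonoid.addOrderOf_eq_one_iff, ← f_one f hf] at h1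
      exact ha (hi h1)
    · omega
  obtain ⟨c', hc', hcc⟩ := ultra U (fun p a => p • f a) (fun p a b => by rw [hf, smul_add]) (by
    intro a b hab
    have : a * b⁻¹ ≠ 1 := fun h => hab (mul_inv_eq_one.1 h)
    filter_upwards [hne _ this] with p hp h0
    apply hp
    have h1 := hf (a * b⁻¹) b
    rw [inv_mul_cancel_right] at h1
    simp only [h1, smul_add] at h0
    simpa using h0)
  refine ⟨c', hc', ?_, ?_⟩
  · have hs : ∀ p ∈ P, ∀ s ∈ S, p • f s = f s := by
      intro p hp s hs
      have h1 := (hu p hp.2).1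
      have h2 : (p : ZMod n) = (1 : ℕ) := by simpa using h1
      rw [ZMod.natCast_eq_natCast_iff] at h2
      have h3 := h2.of_dvd (hnS s hs)
      conv_rhs => rw [← one_nsmul (f s)]
      exact nsmul_eq_nsmul_iff_modEq.2 h3
    intro a ha b hb d hd
    obtain ⟨p, h1, h2⟩ := ((hcc a b d).and hUP).exists
    rw [← h1, hs p h2 a ha, hs p h2 b hb, hs p h2 d hd]
  · intro hcon
    have hfg : f g ≠ 0 := fun h => hg (by rw [h, smul_zero])
    have hval : ∀ p ∈ P, ∀ q ∈ P, p • f g = q • f g := by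
      intro p hp q hq
      have h2 : (p : ZMod m) = (q : ZMod m) := by rw [hp.2, hq.2]
      rw [ZMod.natCast_eq_natCast_iff] at h2
      exact nsmul_eq_nsmul_iff_modEq.2 (h2.of_dvd hdm)
    obtain ⟨p, hp, hp0⟩ := (hUP.and (hne g (fun h => hfg (by rw [h, f_one f hf])))).exists
    have e : f g = p • f g := by
      apply eq_of_circ hfg hp0
      intro k
      obtain ⟨q, h1, hq⟩ := ((hcc 1 (g ^ k) (g ^ (k + 1))).and hUP).exists
      rw [hcon] at h1
      simp only [f_pow f hf, f_one f hf, smul_zero] at h1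
      rw [← h1, hval p hp q hq, smul_comm q k, smul_comm q (k + 1)]
    apply (hu p hp.2).2
    have h3 : 1 • f g = p • f g := by rw [one_nsmul]; exact e
    rw [nsmul_eq_nsmul_iff_modEq, ← ZMod.natCast_eq_natCast_iff] at h3
    simpa using h3.symm

lemma exists_psi (x : S1) (hx : ¬ IsOfFinAddOrder x) : ∃ ψ : S1 →+ ℚ, ψ x ≠ 0 := by
  have hnot : S1.rep x ∉ Submodule.span ℚ {(1 : ℝ)} := by
    intro hmem
    obtain ⟨q, hq⟩ := Submodule.mem_span_singleton.1 hmem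
    apply hx
    rw [isOfFinAddOrder_iff_nsmul_eq_zero]
    refine ⟨q.den, q.den_pos, ?_⟩
    rw [← coe_rep x, ← AddCircle.coe_nsmul, ← hq]
    have : q.den • q • (1 : ℝ) = (q.num : ℝ) := by
      rw [Rat.smul_def, nsmul_eq_mul, mul_one]
      exact_mod_cast Rat.den_mul_eq_num q
    rw [this, AddCircle.coe_eq_zero_iff]
    exact ⟨q.num, by simp⟩
  obtain ⟨F, hF1, hF2⟩ := Submodule.exists_le_ker_of_notMem hnot
  have h1 : F 1 = 0 := hF2 (Submodule.mem_span_singleton_self _)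
  refine ⟨QuotientAddGroup.lift _ F.toAddMonoidHom ?_, ?_⟩
  · rintro y hy
    obtain ⟨k, rfl⟩ := AddSubgroup.mem_zmultiples_iff.1 hy
    show F (k • (1 : ℝ)) = 0
    rw [map_zsmul, h1, smul_zero]
  · rw [← coe_rep x]
    exact hF1

lemma countable_bad (q : ℝ) (hq : q ≠ 0) (z : S1) : {t : ℝ | ((t * q : ℝ) : S1) = z}.Countable := by
  refine (Set.countable_range (fun k : ℤ => (S1.rep z + k) / q)).mono ?_
  intro t ht
  have ht' : ((t * q : ℝ) : S1) = z := ht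
  have h1 : (((t * q - S1.rep z : ℝ)) : S1) = 0 := by
    rw [AddCircle.coe_sub, ht', coe_rep, sub_self]
  obtain ⟨k, hk⟩ := (AddCircle.coe_eq_zero_iff _).1 h1
  refine ⟨k, ?_⟩
  simp only [zsmul_eq_mul, mul_one] at hk
  rw [div_eq_iff hq, hk]; ring

lemma tendsto_circ {l : Filter ℝ} {y z : ℝ → S1} {y0 z0 : S1} (hy : Tendsto y l (𝓝 y0))
    (hz : Tendsto z l (𝓝 z0)) (h1 : y0 ≠ 0) (h2 : z0 ≠ 0) (h3 : y0 ≠ z0) :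
    ∀ᶠ t in l, circOrd 0 (y t) (z t) = circOrd 0 y0 z0 := by
  have hc : ∀ w : S1, w ≠ 0 → ContinuousAt S1.rep w := fun w hw =>
    continuousAt_subtype_val.comp (AddCircle.continuousAt_equivIco (1 : ℝ) 0 (by simpa using hw))
  have ry := (hc y0 h1).tendsto.comp hy
  have rz := (hc z0 h2).tendsto.comp hz
  have ey : ∀ᶠ t in l, y t ≠ 0 := hy.eventually_ne h1
  have ez : ∀ᶠ t in l, z t ≠ 0 := hz.eventually_ne h2
  have hne : S1.rep y0 ≠ S1.rep z0 := fun h => h3 (rep_inj.1 h)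
  rcases lt_or_gt_of_ne hne with hlt | hlt
  · filter_upwards [ey, ez, ry.eventually_lt rz hlt] with t a b c
    rw [circOrd_zero a b, circOrd_zero h1 h2]
    simp only [Function.comp] at c
    unfold sg; rw [if_pos c, if_pos hlt]
  · filter_upwards [ey, ez, rz.eventually_lt ry hlt] with t a b c
    rw [circOrd_zero a b, circOrd_zero h1 h2]
    simp only [Function.comp] at c
    unfold sg; rw [if_neg c.not_gt, if_pos c, if_neg hlt.not_gt, if_pos hlt]

lemma free_case {G : Type*} [Group G] [Countable G] (f : G → S1)
    (hf : ∀ a b, f (a * b) = f a + f b) (hi : Function.Injective f)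
    (g : G) (hg : ¬ IsOfFinAddOrder (f g)) (S : Finset G) :
    ∃ c' : G → G → G → ℤ, IsCircularOrder c' ∧
      (∀ u ∈ S, ∀ v ∈ S, ∀ w ∈ S, c' u v w = circOrd (f u) (f v) (f w)) ∧
      c' ≠ fun a b c => circOrd (f a) (f b) (f c) := by
  obtain ⟨ψ, hψ⟩ := exists_psi (f g) hg
  let F : ℝ → G → S1 := fun t a => f a + ((t * (ψ (f a) : ℝ) : ℝ) : S1)
  have hF : ∀ t a b, F t (a * b) = F t a + F t b := by
    intro t a b
    simp only [F, hf, map_add, Rat.cast_add, mul_add, AddCircle.coe_add]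
    abel
  have hlim : ∀ a, Tendsto (fun t => F t a) (𝓝 0) (𝓝 (f a)) := by
    intro a
    have hcont : Continuous (fun t => F t a) := by
      refine continuous_const.add ?_
      exact (AddCircle.continuous_mk' (1 : ℝ)).comp (continuous_id.mul continuous_const)
    have := hcont.tendsto 0
    simpa [F] using this
  have hev : ∀ᶠ t in 𝓝 (0 : ℝ), ∀ u ∈ S, ∀ v ∈ S, ∀ w ∈ S,
      circOrd (F t u) (F t v) (F t w) = circOrd (f u) (f v) (f w) := by
    simp only [Finset.eventually_all]
    intro u _ v _ w _
    by_cases hd : u = v ∨ v = w ∨ u = w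
    · refine Eventually.of_forall fun t => ?_
      rw [(circOrd_zero_iff _ _ _).2, (circOrd_zero_iff _ _ _).2]
      · rcases hd with h | h | h <;> simp [h]
      · rcases hd with h | h | h <;> simp [h]
    · push Not at hd
      have := tendsto_circ ((hlim v).sub (hlim u)) ((hlim w).sub (hlim u))
        (fun h => hd.1 (hi (sub_eq_zero.1 h)).symm) (fun h => hd.2.2 (hi (sub_eq_zero.1 h)).symm)
        (fun h => hd.2.1 (hi (by simpa using h)))
      filter_upwards [this] with t ht
      rw [circOrd_base, ht, ← circOrd_base]
  let B : Set ℝ := (⋃ a ∈ {a : G | ψ (f a) ≠ 0}, {t : ℝ | ((t * (ψ (f a) : ℝ) : ℝ) : S1) = -f a}) ∪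
    {t : ℝ | ((t * (ψ (f g) : ℝ) : ℝ) : S1) = 0}
  have hB : B.Countable := by
    refine Set.Countable.union (Set.Countable.biUnion (Set.to_countable _) ?_) ?_
    · intro a ha
      exact countable_bad _ (by exact_mod_cast ha) _
    · exact countable_bad _ (by exact_mod_cast hψ) _
  obtain ⟨t, htB, ht⟩ := (hB.dense_compl ℝ).inter_nhds_nonempty hev
  have hinj : Function.Injective (F t) := by
    apply inj_of_ker _ (hF t)
    intro a ha
    have hfa : ψ (f a) = 0 := by
      by_contra hne
      apply htB
      left
      simp only [Set.mem_iUnion]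
      exact ⟨a, hne, (neg_eq_of_add_eq_zero_right ha).symm⟩
    simp only [F, hfa, Rat.cast_zero, mul_zero, AddCircle.coe_zero, add_zero] at ha
    exact hi (by rw [ha, f_one f hf])
  refine ⟨_, circ_of_hom (F t) (hF t) hinj, ht, fun hcon => ?_⟩
  have hg1 : g ≠ 1 := by
    rintro rfl
    exact hg (by rw [f_one f hf]; exact IsOfFinAddOrder.zero)
  have e : F t g = f g := by
    apply eq_of_circ
    · rw [← f_one _ (hF t)]; exact hinj.ne hg1
    · rw [← f_one _ hf]; exact hi.ne hg1
    · intro k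
      have := congrFun (congrFun (congrFun hcon 1) (g ^ k)) (g ^ (k + 1))
      simpa only [f_pow _ hf, f_pow _ (hF t), f_one _ hf, f_one _ (hF t)] using this
  apply htB
  right
  simpa [F] using e

end RotAux

noncomputable section

/-- **Infinite groups of rotations are not isolated.**  If `ι : G → ℝ/ℤ` is an injective
homomorphism of a countable infinite group into the circle group, then the circular order
`c(g₁,g₂,g₃) = ord(ι g₁, ι g₂, ι g₃)` on `G` is a circular order which is not isolated in
`CO(G)`. -/
theorem rotation_group_order_not_isolated {G : Type*} [Group G] [Countable G] [Infinite G]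
    (ι : G →* Multiplicative S1) (hι : Function.Injective ι) :
    IsCircularOrder (fun g₁ g₂ g₃ : G =>
        circOrd (Multiplicative.toAdd (ι g₁)) (Multiplicative.toAdd (ι g₂))
          (Multiplicative.toAdd (ι g₃))) ∧
    ¬ IsIsolatedCO (fun g₁ g₂ g₃ : G =>
        circOrd (Multiplicative.toAdd (ι g₁)) (Multiplicative.toAdd (ι g₂))
          (Multiplicative.toAdd (ι g₃))) := by
  have hf : ∀ a b : G, Multiplicative.toAdd (ι (a * b)) =
      Multiplicative.toAdd (ι a) + Multiplicative.toAdd (ι b) := fun a b => by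
    rw [map_mul, toAdd_mul]
  have hi : Function.Injective (fun a : G => Multiplicative.toAdd (ι a)) :=
    fun a b h => hι (Multiplicative.toAdd.injective h)
  refine ⟨RotAux.circ_of_hom (fun a => Multiplicative.toAdd (ι a)) hf hi, ?_⟩
  rintro ⟨S, hS⟩
  by_cases ht : ∀ g, IsOfFinAddOrder (Multiplicative.toAdd (ι g))
  · obtain ⟨c', h1, h2, h3⟩ := RotAux.torsion_case (fun a => Multiplicative.toAdd (ι a)) hf hi ht S
    exact h3 (hS c' h1 h2)
  · obtain ⟨g, hg⟩ := not_forall.1 ht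
    obtain ⟨c', h1, h2, h3⟩ := RotAux.free_case (fun a => Multiplicative.toAdd (ι a)) hf hi g hg S
    exact h3 (hS c' h1 h2)

end
end

section
/- Let G be a finitely generated group and z a central element of G. Then the set of left orders on G in which z is cofinal is an open subset of LO(G). -/
noncomputable section

/-- **Cofinality of a central element is an open condition.**  Let `G` be a finitely
generated group and `z` a central element.  The set of left orders on `G` in which `z` is
cofinal is open in `LO(G)`: every such order has a basic neighborhood (agreement on a
finite set) consisting of orders in which `z` is cofinal. -/
theorem cofinal_central_open {G : Type*} [Group G] [Group.FG G]
    (z : G) (hz : ∀ g : G, g * z = z * g)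
    (r : G → G → Prop) (hr : IsLeftOrder r) (hcof : ∀ g : G, ∃ n : ℕ, r g (z ^ n)) :
    ∃ S : Finset G, ∀ r' : G → G → Prop, IsLeftOrder r' →
      (∀ a ∈ S, ∀ b ∈ S, (r' a b ↔ r a b)) →
      ∀ g : G, ∃ n : ℕ, r' g (z ^ n) := by
  classical
  obtain ⟨T, hT⟩ := (Group.fg_def (G := G)).1 inferInstance
  choose f hf using hcof
  let U : Finset G := insert 1 (T ∪ T.image (fun x => x⁻¹))
  refine ⟨U ∪ U.image (fun s => z ^ f s), ?_⟩
  intro r' hr' hag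
  have key : ∀ s ∈ U, r' s (z ^ f s) := fun s hs =>
    (hag s (Finset.mem_union_left _ hs) _
      (Finset.mem_union_right _ (Finset.mem_image_of_mem _ hs))).2 (hf s)
  obtain ⟨_, htr, _, hinv⟩ := hr'
  have step : ∀ s ∈ U, ∀ g, (∃ n : ℕ, r' g (z ^ n)) → ∃ n : ℕ, r' (s * g) (z ^ n) := by
    rintro s hs g ⟨n, hn⟩
    refine ⟨n + f s, htr _ _ _ (hinv s _ _ hn) ?_⟩
    have hc : s * z ^ n = z ^ n * s := (Commute.pow_right (hz s) n)
    rw [hc, pow_add]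
    exact hinv _ _ _ (key s hs)
  intro g
  have hg : g ∈ Subgroup.closure (T : Set G) := by rw [hT]; trivial
  induction hg using Subgroup.closure_induction_left with
  | one => exact ⟨_, key 1 (by simp [U])⟩
  | mul_left x hx y _ ih => exact step x (by simp [U]; right; left; exact hx) y ih
  | inv_mul_cancel x hx y _ ih =>
    exact step x⁻¹ (by simp [U]; right; right; exact hx) y ih

end
end
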